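/- arXiv:1110.6027 — 4 statements merged into one kernel-verified Lean document; each statement's English description precedes it below -/
import Mathlib

section
/- Let X be a metric space with Borel σ-algebra Σ, let n ∈ ℕ, let a₁,…,aₙ ∈ [0,1] with Σ_{k=1}^n a_k = 1, and let μ₁,…,μₙ be Borel probability measures on X, each of which has an entropy dimension (i.e. its lower and upper entropy dimensions coincide). Then Σ_{k=1}^n a_k μ_k has an entropy dimension and dim_E(Σ_{k=1}^n a_k μ_k) = Σ_{k=1}^n a_k dim_E(μ_k). -/
open MeasureTheory ENNReal

/-- The Shannon function `sh(x) = -x·log₂ x` (with `sh 0 = 0`). -/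
noncomputable def sh (x : ℝ) : ℝ := -(x * Real.logb 2 x)

/-- `P` is a `μ`-partition of `X`: a countable family of pairwise disjoint
measurable sets covering `X` up to a `μ`-null set. -/
def IsMuPartition {X : Type*} [MeasurableSpace X] (μ : Measure X) (P : Set (Set X)) : Prop :=
  P.Countable ∧ (∀ s ∈ P, MeasurableSet s) ∧ P.Pairwise Disjoint ∧ μ (⋃₀ P)ᶜ = 0

/-- The `μ`-entropy `h(μ;P) = Σ_{P∈P} sh(μ(P))` of a family of sets. -/
noncomputable def partEntropy {X : Type*} [MeasurableSpace X] (μ : Measure X)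
    (P : Set (Set X)) : ℝ≥0∞ :=
  ∑' s : P, ENNReal.ofReal (sh (μ s).toReal)

/-- `P ≺ Q` : every element of `P` is contained in some element of `Q`. -/
def Finer {X : Type*} (P Q : Set (Set X)) : Prop := ∀ p ∈ P, ∃ q ∈ Q, p ⊆ q

/-- The (classical) `μ`-entropy of a family `Q`:
`H(μ;Q) = inf { h(μ;P) : P a μ-partition, P ≺ Q }`, with `inf ∅ = ∞`. -/
noncomputable def entropyH {X : Type*} [MeasurableSpace X] (μ : Measure X)
    (Q : Set (Set X)) : ℝ≥0∞ :=
  ⨅ (P : Set (Set X)) (_ : IsMuPartition μ P) (_ : Finer P Q), partEntropy μ P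

/-- `m ∈ V(μ;Q)` : a weighting of `Q`, i.e. `m : Q → Measure X` with
`m_Q(X \ Q) = 0` for all `Q ∈ Q` and `Σ_{Q∈Q} m_Q = μ`. -/
def IsWeighting {X : Type*} [MeasurableSpace X] (μ : Measure X) (Q : Set (Set X))
    (m : Q → Measure X) : Prop :=
  (∀ q : Q, m q ((q : Set X))ᶜ = 0) ∧ Measure.sum m = μ

/-- The weighted `μ`-entropy of `m ∈ V(μ;Q)` : `hv(μ;m) = Σ_{Q∈Q} sh(m_Q(X))`. -/
noncomputable def wEntropy {X : Type*} [MeasurableSpace X] (Q : Set (Set X))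
    (m : Q → Measure X) : ℝ≥0∞ :=
  ∑' q : Q, ENNReal.ofReal (sh ((m q) Set.univ).toReal)

/-- The weighted `μ`-entropy of `Q` : `Hv(μ;Q) = inf { hv(μ;m) : m ∈ V(μ;Q) }`,
with `inf ∅ = ∞`. -/
noncomputable def entropyHv {X : Type*} [MeasurableSpace X] (μ : Measure X)
    (Q : Set (Set X)) : ℝ≥0∞ :=
  ⨅ (m : Q → Measure X) (_ : IsWeighting μ Q m), wEntropy Q m

/-- The family of all closed balls of radius `δ`. -/
def ballFam (X : Type*) [PseudoMetricSpace X] (δ : ℝ) : Set (Set X) :=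
  Set.range (fun x : X => Metric.closedBall x δ)

/-- The lower entropy dimension `liminf_{δ→0⁺} H(μ;B_δ)/(-log₂ δ)`. -/
noncomputable def ldimE {X : Type*} [PseudoMetricSpace X] [MeasurableSpace X]
    (μ : Measure X) : ℝ≥0∞ :=
  Filter.liminf (fun δ : ℝ => entropyH μ (ballFam X δ) / ENNReal.ofReal (-Real.logb 2 δ))
    (nhdsWithin 0 (Set.Ioi 0))

/-- The upper entropy dimension `limsup_{δ→0⁺} H(μ;B_δ)/(-log₂ δ)`. -/
noncomputable def udimE {X : Type*} [PseudoMetricSpace X] [MeasurableSpace X]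
    (μ : Measure X) : ℝ≥0∞ :=
  Filter.limsup (fun δ : ℝ => entropyH μ (ballFam X δ) / ENNReal.ofReal (-Real.logb 2 δ))
    (nhdsWithin 0 (Set.Ioi 0))

/-- `N_δ(S)` : the smallest number of closed balls of radius `δ` needed to cover `S`. -/
noncomputable def coverNum {X : Type*} [PseudoMetricSpace X] (S : Set X) (δ : ℝ) : ℝ≥0∞ :=
  ⨅ (t : Finset X) (_ : S ⊆ ⋃ x ∈ t, Metric.closedBall x δ), (t.card : ℝ≥0∞)

/-- The natural logarithm on `ℝ≥0∞` (with `log ∞ = ∞`), truncated to `ℝ≥0∞`. -/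
noncomputable def logENN (x : ℝ≥0∞) : ℝ≥0∞ :=
  if x = ⊤ then ⊤ else ENNReal.ofReal (Real.log x.toReal)

/-- The upper box dimension `limsup_{δ→0⁺} log N_δ(S)/(-log δ)`. -/
noncomputable def ubdimB {X : Type*} [PseudoMetricSpace X] (S : Set X) : ℝ≥0∞ :=
  Filter.limsup (fun δ : ℝ => logENN (coverNum S δ) / ENNReal.ofReal (-Real.log δ))
    (nhdsWithin 0 (Set.Ioi 0))

/-- The upper local dimension `D̄_μ(x) = limsup_{δ→0⁺} log μ(B(x,δ))/log δ`
(interpreted as `∞` when `μ(B(x,δ)) = 0`). -/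
noncomputable def upLocalDim {X : Type*} [PseudoMetricSpace X] [MeasurableSpace X]
    (μ : Measure X) (x : X) : ℝ≥0∞ :=
  Filter.limsup
    (fun δ : ℝ => if μ (Metric.closedBall x δ) = 0 then ⊤ else
      ENNReal.ofReal (Real.log (μ (Metric.closedBall x δ)).toReal / Real.log δ))
    (nhdsWithin 0 (Set.Ioi 0))

open Filter Topology Set

lemma sh_eq_negMulLog_div (x : ℝ) : sh x = Real.negMulLog x / Real.log 2 := by
  simp only [sh, Real.negMulLog, Real.logb]
  ring

lemma sh_nonneg {x : ℝ} (h0 : 0 ≤ x) (h1 : x ≤ 1) : 0 ≤ sh x := by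
  rw [sh_eq_negMulLog_div]
  exact div_nonneg (Real.negMulLog_nonneg h0 h1) (Real.log_nonneg one_le_two)

lemma concaveOn_sh : ConcaveOn ℝ (Ici 0) sh := by
  have h := Real.concaveOn_negMulLog.smul (inv_nonneg.2 (Real.log_nonneg one_le_two))
  refine h.congr fun x _ => ?_
  simp [sh_eq_negMulLog_div, div_eq_inv_mul]

/-- A one-term Gibbs inequality for codes with integer lengths. -/
lemma sh_le_mul_add_two_mul_pow {p : ℝ} (hp : 0 ≤ p) (c : ℕ) :
    sh p ≤ p * c + 2 * (1 / 2) ^ c := by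
  rcases hp.eq_or_lt with rfl | hp
  · simp [sh]
  have hl : (1 / 2 : ℝ) < Real.log 2 := by linarith [Real.log_two_gt_d9]
  have hq : (0 : ℝ) < (1 / 2) ^ c := by positivity
  have h := Real.log_le_sub_one_of_pos (div_pos hq hp)
  rw [Real.log_div hq.ne' hp.ne', Real.log_pow, one_div, Real.log_inv, ← one_div] at h
  have h2 := mul_le_mul_of_nonneg_left h hp.le
  have h3 : p * ((1 / 2) ^ c / p - 1) = (1 / 2) ^ c - p := by field_simp
  rw [h3] at h2
  rw [sh_eq_negMulLog_div, div_le_iff₀ (by linarith), Real.negMulLog]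
  nlinarith

lemma half_pow_natCeil_le {p : ℝ} (hp : 0 < p) :
    (1 / 2 : ℝ) ^ ⌈-Real.logb 2 p⌉₊ ≤ p := by
  have h := Nat.le_ceil (-Real.logb 2 p)
  have h2 : (1 / 2 : ℝ) ^ ⌈-Real.logb 2 p⌉₊ = 2 ^ (-(⌈-Real.logb 2 p⌉₊ : ℝ)) := by
    rw [Real.rpow_neg zero_le_two, Real.rpow_natCast, one_div, inv_pow]
  rw [h2]
  calc (2 : ℝ) ^ (-(⌈-Real.logb 2 p⌉₊ : ℝ)) ≤ 2 ^ Real.logb 2 p :=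
        Real.rpow_le_rpow_of_exponent_le one_le_two (by linarith)
    _ = p := Real.rpow_logb two_pos (by norm_num) hp

lemma natCeil_mul_le_sh_add {p : ℝ} (h0 : 0 ≤ p) (h1 : p ≤ 1) :
    (⌈-Real.logb 2 p⌉₊ : ℝ) * p ≤ sh p + p := by
  have h : (0 : ℝ) ≤ -Real.logb 2 p :=
    neg_nonneg.2 (Real.logb_nonpos one_lt_two h0 h1)
  have := mul_le_mul_of_nonneg_right (Nat.ceil_lt_add_one h).le h0
  rw [sh]
  linarith

/-- Disjointification of a countable family in which every point is assigned to a member of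
least cost containing it. -/
lemma exists_disjoint_refinement_of_cost {X ι : Type*} [MeasurableSpace X] [Countable ι]
    (Q : ι → Set X) (hQ : ∀ i, MeasurableSet (Q i)) (c : ι → ℕ) :
    ∃ E : ι → Set X, (∀ i, MeasurableSet (E i)) ∧ Pairwise (Function.onFun Disjoint E) ∧
      (∀ i, E i ⊆ Q i) ∧ (∀ i, Q i ⊆ ⋃ j, E j) ∧
      ∀ i j x, x ∈ E i → x ∈ Q j → c i ≤ c j := by
  obtain ⟨e, he⟩ := exists_injective_nat ι
  let r : ι → ℕ ×ₗ ℕ := fun i => toLex (c i, e i)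
  have hr : Function.Injective r := fun i j hij =>
    he (congrArg (fun z : ℕ ×ₗ ℕ => (ofLex z).2) hij)
  refine ⟨fun i => Q i \ ⋃ j, ⋃ (_ : r j < r i), Q j, fun i => ?_, fun i j hij => ?_,
    fun i => sdiff_subset, fun i x hx => ?_, fun i j x hx hxj => ?_⟩
  · exact (hQ i).diff (.iUnion fun j => .iUnion fun _ => hQ j)
  · rw [Function.onFun, Set.disjoint_left]
    rintro x ⟨hi, hi'⟩ ⟨hj, hj'⟩
    simp only [mem_iUnion, not_exists] at hi' hj'
    rcases lt_or_gt_of_ne (hr.ne hij) with h | h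
    · exact hj' i h hi
    · exact hi' j h hj
  · obtain ⟨j, hj, hmin⟩ :=
      (InvImage.wf r (wellFounded_lt (α := ℕ ×ₗ ℕ))).has_min {j | x ∈ Q j} ⟨i, hx⟩
    refine mem_iUnion.2 ⟨j, hj, ?_⟩
    simp only [mem_iUnion, not_exists]
    exact fun k hk hxk => hmin k hxk hk
  · by_contra! h
    refine hx.2 (mem_iUnion.2 ⟨j, mem_iUnion.2 ⟨?_, hxj⟩⟩)
    exact Prod.Lex.toLex_lt_toLex.2 (Or.inl h)

section Mixture

variable {X : Type*} [MeasurableSpace X] {n : ℕ} {a : Fin n → ℝ} {μ : Fin n → Measure X}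

lemma mixture_apply (s : Set X) :
    (∑ k, ENNReal.ofReal (a k) • μ k) s = ∑ k, ENNReal.ofReal (a k) * μ k s := by
  simp [Measure.finsetSum_apply]

lemma ofReal_mul_partEntropy_le [∀ k, IsProbabilityMeasure (μ k)]
    (ha : ∀ k, 0 ≤ a k) (hsum : ∑ k, a k = 1) (P : Set (Set X)) :
    ∑ k, ENNReal.ofReal (a k) * partEntropy (μ k) P ≤
      partEntropy (∑ k, ENNReal.ofReal (a k) • μ k) P := by
  simp only [partEntropy, ← ENNReal.tsum_mul_left]
  rw [← Summable.tsum_finsetSum fun _ _ => ENNReal.summable]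
  refine ENNReal.tsum_le_tsum fun s => ?_
  have hsh : ∀ k, 0 ≤ sh ((μ k) s).toReal := fun k =>
    sh_nonneg ENNReal.toReal_nonneg measureReal_le_one
  have h := concaveOn_sh.le_map_sum (t := Finset.univ) (w := a)
    (p := fun k => ((μ k) s).toReal) (fun k _ => ha k) hsum
    (fun k _ => ENNReal.toReal_nonneg)
  have hval : ((∑ k, ENNReal.ofReal (a k) • μ k) s).toReal = ∑ k, a k • ((μ k) s).toReal := by
    rw [mixture_apply, ENNReal.toReal_sum
      fun k _ => ENNReal.mul_ne_top ENNReal.ofReal_ne_top (measure_ne_top _ _)]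
    simp [ENNReal.toReal_mul, ENNReal.toReal_ofReal (ha _)]
  rw [hval]
  refine le_trans (le_of_eq ?_) (ENNReal.ofReal_le_ofReal h)
  rw [ENNReal.ofReal_sum_of_nonneg fun k _ => smul_nonneg (ha k) (hsh k)]
  simp [ENNReal.ofReal_mul (ha _)]

lemma sum_mul_entropyH_le [∀ k, IsProbabilityMeasure (μ k)]
    (ha : ∀ k, 0 ≤ a k) (hsum : ∑ k, a k = 1) (Q : Set (Set X)) :
    ∑ k, ENNReal.ofReal (a k) * entropyH (μ k) Q ≤
      entropyH (∑ k, ENNReal.ofReal (a k) • μ k) Q := by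
  refine le_iInf fun P => le_iInf fun hP => le_iInf fun hPQ =>
    le_trans (Finset.sum_le_sum fun k _ => ?_) (ofReal_mul_partEntropy_le ha hsum P)
  by_cases hk : ENNReal.ofReal (a k) = 0
  · simp [hk]
  have h0 := hP.2.2.2
  rw [mixture_apply, Finset.sum_eq_zero_iff] at h0
  have hPk : IsMuPartition (μ k) P :=
    ⟨hP.1, hP.2.1, hP.2.2.1, (mul_eq_zero.1 (h0 k (Finset.mem_univ k))).resolve_left hk⟩
  gcongr
  exact iInf_le_of_le P (iInf_le_of_le hPk (iInf_le _ hPQ))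

/-- If every point of `E i` is charged at most the cost of each cell of `P` containing it, then
the total cost of a disjoint family `E` is at most the total cost of `P`. -/
lemma tsum_cost_mul_measure_le {ι : Type*} [Countable ι] {ν : Measure X} {P : Set (Set X)}
    (hP : IsMuPartition ν P) {E : ι → Set X} (hE : ∀ i, MeasurableSet (E i))
    (hEd : Pairwise (Function.onFun Disjoint E)) (c : ι → ℕ) (d : Set X → ℕ)
    (hcd : ∀ i, ∀ s ∈ P, ν s ≠ 0 → ∀ x ∈ E i, x ∈ s → c i ≤ d s) :
    ∑' i, (c i : ℝ≥0∞) * ν (E i) ≤ ∑' s : P, (d s : ℝ≥0∞) * ν s := by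
  have : Countable P := hP.1.to_subtype
  have hsplit : ∀ i, ν (E i) ≤ ∑' s : P, ν (E i ∩ s) := fun i =>
    calc ν (E i) ≤ ν ((⋃ s : P, E i ∩ s) ∪ (⋃₀ P)ᶜ) := by
          refine measure_mono fun x hx => ?_
          by_cases h : x ∈ ⋃₀ P
          · obtain ⟨s, hs, hxs⟩ := h
            exact Or.inl (mem_iUnion.2 ⟨⟨s, hs⟩, hx, hxs⟩)
          · exact Or.inr h
      _ ≤ ν (⋃ s : P, E i ∩ s) + ν (⋃₀ P)ᶜ := measure_union_le _ _
      _ ≤ ∑' s : P, ν (E i ∩ s) := by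
          rw [hP.2.2.2, add_zero]
          exact measure_iUnion_le _
  calc ∑' i, (c i : ℝ≥0∞) * ν (E i)
      ≤ ∑' i, ∑' s : P, (c i : ℝ≥0∞) * ν (E i ∩ s) := by
        refine ENNReal.tsum_le_tsum fun i => ?_
        rw [ENNReal.tsum_mul_left]
        gcongr
        exact hsplit i
    _ ≤ ∑' i, ∑' s : P, (d s : ℝ≥0∞) * ν (E i ∩ s) := by
        refine ENNReal.tsum_le_tsum fun i => ENNReal.tsum_le_tsum fun s => ?_
        by_cases h0 : ν (E i ∩ s) = 0
        · simp [h0]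
        obtain ⟨x, hx⟩ := nonempty_of_measure_ne_zero h0
        have hs : ν s ≠ 0 := fun h => h0 (measure_mono_null inter_subset_right h)
        gcongr
        exact hcd i s s.2 hs x hx.1 hx.2
    _ = ∑' s : P, (d s : ℝ≥0∞) * ∑' i, ν (E i ∩ s) := by
        rw [ENNReal.tsum_comm]
        simp only [ENNReal.tsum_mul_left]
    _ ≤ ∑' s : P, (d s : ℝ≥0∞) * ν s := by
        refine ENNReal.tsum_le_tsum fun s => ?_
        gcongr
        rw [← measure_iUnion (fun i j hij => (hEd hij).mono inter_subset_left inter_subset_left)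
          fun i => (hE i).inter (hP.2.1 s s.2)]
        exact measure_mono (iUnion_subset fun i => inter_subset_right)

lemma tsum_measure_partition_le_one {ν : Measure X} [IsProbabilityMeasure ν] {P : Set (Set X)}
    (hP : IsMuPartition ν P) : ∑' s : P, ν s ≤ 1 := by
  have : Countable P := hP.1.to_subtype
  rw [← measure_iUnion (fun s t hst => hP.2.2.1 s.2 t.2 (Subtype.coe_injective.ne hst))
    fun s => hP.2.1 s s.2]
  exact prob_le_one

lemma tsum_natCeil_mul_measure_le {ν : Measure X} [IsProbabilityMeasure ν] {P : Set (Set X)}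
    (hP : IsMuPartition ν P) :
    ∑' s : P, (⌈-Real.logb 2 (ν s).toReal⌉₊ : ℝ≥0∞) * ν s ≤ partEntropy ν P + 1 := by
  refine le_trans ?_ (add_le_add_right (tsum_measure_partition_le_one hP) _)
  rw [partEntropy, ← ENNReal.tsum_add]
  refine ENNReal.tsum_le_tsum fun s => ?_
  have h0 : 0 ≤ (ν s).toReal := ENNReal.toReal_nonneg
  have h1 : (ν s).toReal ≤ 1 := measureReal_le_one
  have h := ENNReal.ofReal_le_ofReal (natCeil_mul_le_sh_add h0 h1)
  rwa [ENNReal.ofReal_add (sh_nonneg h0 h1) h0, ENNReal.ofReal_mul (Nat.cast_nonneg _),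
    ENNReal.ofReal_natCast, ENNReal.ofReal_toReal (measure_ne_top _ _)] at h

lemma partEntropy_range_le {ι : Type*} (ν : Measure X) [IsFiniteMeasure ν] (E : ι → Set X)
    (c : ι → ℕ) :
    partEntropy ν (range E) ≤
      ∑' i, (c i : ℝ≥0∞) * ν (E i) + 2 * ∑' i, ENNReal.ofReal ((1 / 2) ^ c i) := by
  have h1 : partEntropy ν (range E) ≤ ∑' i, ENNReal.ofReal (sh (ν (E i)).toReal) := by
    choose g hg using fun s : range E => s.2
    have hinj : Function.Injective g := fun s t hst =>
      Subtype.ext (by rw [← hg s, ← hg t, hst])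
    have := ENNReal.tsum_comp_le_tsum_of_injective hinj
      (fun i => ENNReal.ofReal (sh (ν (E i)).toReal))
    simpa only [partEntropy, hg] using this
  refine h1.trans ?_
  rw [← ENNReal.tsum_mul_left, ← ENNReal.tsum_add]
  refine ENNReal.tsum_le_tsum fun i => ?_
  have h0 : 0 ≤ (ν (E i)).toReal := ENNReal.toReal_nonneg
  refine (ENNReal.ofReal_le_ofReal (sh_le_mul_add_two_mul_pow h0 (c i))).trans (le_of_eq ?_)
  rw [ENNReal.ofReal_add (by positivity) (by positivity), ENNReal.ofReal_mul h0,
    ENNReal.ofReal_mul zero_le_two, ENNReal.ofReal_natCast,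
    ENNReal.ofReal_toReal (measure_ne_top _ _), mul_comm]
  simp

lemma entropyH_mixture_le_partEntropy [∀ k, IsProbabilityMeasure (μ k)]
    (ha : ∀ k, 0 ≤ a k) (hsum : ∑ k, a k = 1) (Q : Set (Set X)) (P : Fin n → Set (Set X))
    (hP : ∀ k, ENNReal.ofReal (a k) ≠ 0 → IsMuPartition (μ k) (P k) ∧ Finer (P k) Q) :
    entropyH (∑ k, ENNReal.ofReal (a k) • μ k) Q ≤
      ∑ k, ENNReal.ofReal (a k) * partEntropy (μ k) (P k) + (1 + 2 * n) := by
  let J : Fin n → Set (Set X) := fun k =>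
    {s | ENNReal.ofReal (a k) ≠ 0 ∧ s ∈ P k ∧ μ k s ≠ 0}
  let d : Fin n → Set X → ℕ := fun k s => ⌈-Real.logb 2 (μ k s).toReal⌉₊
  have hJ : ∀ k, (J k).Countable := fun k => by
    by_cases hk : ENNReal.ofReal (a k) = 0
    · exact countable_empty.mono fun s hs => hs.1 hk
    · exact (hP k hk).1.1.mono fun s hs => hs.2.1
  have : ∀ k, Countable (J k) := fun k => (hJ k).to_subtype
  let c : (Σ k, J k) → ℕ := fun i => d i.1 i.2
  obtain ⟨E, hEm, hEd, hEQ, hQE, hEc⟩ :=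
    exists_disjoint_refinement_of_cost (fun i : Σ k, J k => (i.2 : Set X))
      (fun i => (hP i.1 i.2.2.1).1.2.1 _ i.2.2.2.1) c
  set ν := ∑ k, ENNReal.ofReal (a k) • μ k with hν
  have hsumE : ∑ k, ENNReal.ofReal (a k) = 1 := by
    rw [← ENNReal.ofReal_sum_of_nonneg fun k _ => ha k, hsum, ENNReal.ofReal_one]
  have : IsProbabilityMeasure ν := ⟨by rw [hν, mixture_apply]; simp [hsumE]⟩
  have hpart : IsMuPartition ν (range E) := by
    refine ⟨countable_range E, forall_mem_range.2 hEm, ?_, ?_⟩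
    · rintro _ ⟨i, rfl⟩ _ ⟨j, rfl⟩ hij
      exact hEd fun h => hij (h ▸ rfl)
    · rw [hν, mixture_apply]
      refine Finset.sum_eq_zero fun k _ => ?_
      by_cases hk : ENNReal.ofReal (a k) = 0
      · simp [hk]
      have hnull : μ k (⋃₀ (P k ∩ {s | μ k s = 0})) = 0 :=
        (measure_sUnion_null_iff ((hP k hk).1.1.mono inter_subset_left)).2 fun s hs => hs.2
      refine mul_eq_zero_of_right _ (measure_mono_null ?_
        (measure_union_null (hP k hk).1.2.2.2 hnull))
      intro x hx
      by_contra hx'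
      simp only [mem_union, mem_compl_iff, not_or, not_not] at hx'
      obtain ⟨⟨s, hs, hxs⟩, hx2⟩ := hx'
      refine hx ?_
      rw [sUnion_range]
      exact hQE ⟨k, s, hk, hs, fun h0 => hx2 ⟨s, ⟨hs, h0⟩, hxs⟩⟩ hxs
  have hfiner : Finer (range E) Q := by
    rintro _ ⟨i, rfl⟩
    obtain ⟨q, hq, hsub⟩ := (hP i.1 i.2.2.1).2 _ i.2.2.2.1
    exact ⟨q, hq, (hEQ i).trans hsub⟩
  have hcost : ∑' i, (c i : ℝ≥0∞) * ν (E i) ≤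
      ∑ k, ENNReal.ofReal (a k) * partEntropy (μ k) (P k) + 1 := by
    calc ∑' i, (c i : ℝ≥0∞) * ν (E i)
        = ∑ k, ENNReal.ofReal (a k) * ∑' i, (c i : ℝ≥0∞) * μ k (E i) := by
          simp only [hν, mixture_apply, Finset.mul_sum]
          rw [Summable.tsum_finsetSum fun _ _ => ENNReal.summable]
          simp only [← ENNReal.tsum_mul_left, mul_left_comm]
      _ ≤ ∑ k, ENNReal.ofReal (a k) * (partEntropy (μ k) (P k) + 1) := by
          refine Finset.sum_le_sum fun k _ => ?_
          by_cases hk : ENNReal.ofReal (a k) = 0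
          · simp [hk]
          gcongr
          exact (tsum_cost_mul_measure_le (hP k hk).1 hEm hEd c (d k) fun i s hs h0 x hx hxs =>
            hEc i ⟨k, s, hk, hs, h0⟩ x hx hxs).trans (tsum_natCeil_mul_measure_le (hP k hk).1)
      _ = ∑ k, ENNReal.ofReal (a k) * partEntropy (μ k) (P k) + 1 := by
          simp [mul_add, Finset.sum_add_distrib, hsumE]
  have hkraft : ∑' i, ENNReal.ofReal ((1 / 2) ^ c i) ≤ n := by
    rw [ENNReal.tsum_sigma', tsum_fintype]
    calc ∑ k, ∑' s : J k, ENNReal.ofReal ((1 / 2) ^ d k s)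
        ≤ ∑ _k : Fin n, (1 : ℝ≥0∞) := Finset.sum_le_sum fun k _ => ?_
      _ = n := by simp
    by_cases hk : ENNReal.ofReal (a k) = 0
    · have : IsEmpty (J k) := ⟨fun s => s.2.1 hk⟩
      simp
    refine le_trans (ENNReal.tsum_le_tsum fun s : J k => ?_)
      ((ENNReal.tsum_mono_subtype (μ k) fun s (hs : s ∈ J k) => hs.2.1).trans
        (tsum_measure_partition_le_one (hP k hk).1))
    have hpos : 0 < (μ k s).toReal := ENNReal.toReal_pos s.2.2.2 (measure_ne_top _ _)
    exact ENNReal.ofReal_le_of_le_toReal (half_pow_natCeil_le hpos)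
  calc entropyH ν Q ≤ partEntropy ν (range E) :=
        iInf_le_of_le _ (iInf_le_of_le hpart (iInf_le _ hfiner))
    _ ≤ _ := partEntropy_range_le ν E c
    _ ≤ ∑ k, ENNReal.ofReal (a k) * partEntropy (μ k) (P k) + 1 + 2 * n := by gcongr
    _ = _ := add_assoc _ _ _

lemma exists_partition_partEntropy_le {ν : Measure X} {Q : Set (Set X)}
    (h : entropyH ν Q ≠ ⊤) :
    ∃ P, IsMuPartition ν P ∧ Finer P Q ∧ partEntropy ν P ≤ entropyH ν Q + 1 := by
  have hlt : entropyH ν Q < entropyH ν Q + 1 := ENNReal.lt_add_right h one_ne_zero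
  conv_lhs at hlt => rw [entropyH]
  simp only [iInf_lt_iff] at hlt
  obtain ⟨P, hP, hPQ, hle⟩ := hlt
  exact ⟨P, hP, hPQ, hle.le⟩

lemma entropyH_mixture_le [∀ k, IsProbabilityMeasure (μ k)]
    (ha : ∀ k, 0 ≤ a k) (hsum : ∑ k, a k = 1) (Q : Set (Set X)) :
    entropyH (∑ k, ENNReal.ofReal (a k) • μ k) Q ≤
      ∑ k, ENNReal.ofReal (a k) * entropyH (μ k) Q + (2 + 2 * n) := by
  by_cases hfin : ∀ k, ENNReal.ofReal (a k) ≠ 0 → entropyH (μ k) Q ≠ ⊤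
  · have hex : ∀ k, ∃ P, ENNReal.ofReal (a k) ≠ 0 → IsMuPartition (μ k) P ∧ Finer P Q ∧
        partEntropy (μ k) P ≤ entropyH (μ k) Q + 1 := fun k => by
      by_cases hk : ENNReal.ofReal (a k) = 0
      · exact ⟨∅, fun h => absurd hk h⟩
      · obtain ⟨P, hP⟩ := exists_partition_partEntropy_le (hfin k hk)
        exact ⟨P, fun _ => hP⟩
    choose P hP using hex
    have hsumE : ∑ k, ENNReal.ofReal (a k) = 1 := by
      rw [← ENNReal.ofReal_sum_of_nonneg fun k _ => ha k, hsum, ENNReal.ofReal_one]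
    calc entropyH (∑ k, ENNReal.ofReal (a k) • μ k) Q
        ≤ ∑ k, ENNReal.ofReal (a k) * partEntropy (μ k) (P k) + (1 + 2 * n) :=
          entropyH_mixture_le_partEntropy ha hsum Q P fun k hk => ⟨(hP k hk).1, (hP k hk).2.1⟩
      _ ≤ ∑ k, ENNReal.ofReal (a k) * (entropyH (μ k) Q + 1) + (1 + 2 * n) := by
          gcongr ?_ + _
          refine Finset.sum_le_sum fun k _ => ?_
          by_cases hk : ENNReal.ofReal (a k) = 0
          · simp [hk]
          gcongr
          exact (hP k hk).2.2
      _ = ∑ k, ENNReal.ofReal (a k) * entropyH (μ k) Q + (2 + 2 * n) := by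
          simp only [mul_add, Finset.sum_add_distrib, mul_one, hsumE]
          ring
  · push Not at hfin
    obtain ⟨k, hk, htop⟩ := hfin
    have : ∑ k, ENNReal.ofReal (a k) * entropyH (μ k) Q = ⊤ :=
      ENNReal.sum_eq_top.2 ⟨k, Finset.mem_univ k, by rw [htop, ENNReal.mul_top hk]⟩
    simp [this]

end Mixture

lemma tendsto_div_ofReal_neg_logb {C : ℝ≥0∞} (hC : C ≠ ⊤) :
    Tendsto (fun δ : ℝ => C / ENNReal.ofReal (-Real.logb 2 δ)) (𝓝[>] 0) (𝓝 0) := by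
  have h : Tendsto (fun δ : ℝ => ENNReal.ofReal (-Real.logb 2 δ)) (𝓝[>] 0) (𝓝 ⊤) :=
    ENNReal.tendsto_ofReal_atTop.comp
      (tendsto_neg_atBot_atTop.comp (Real.tendsto_logb_nhdsGT_zero one_lt_two))
  simpa using ENNReal.Tendsto.const_div h (Or.inr hC)

/-- Corollary 2 of the paper: if every `μ_k` has entropy dimension
(i.e. `ldim_E(μ_k) = udim_E(μ_k)`), then the mixture `Σ_k a_k μ_k` has entropy dimension and
`dim_E(Σ_k a_k μ_k) = Σ_k a_k dim_E(μ_k)`. -/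
theorem dimE_mixture {X : Type*} [MetricSpace X] [MeasurableSpace X] [BorelSpace X]
    (n : ℕ) (a : Fin n → ℝ) (ha : ∀ k, a k ∈ Set.Icc (0 : ℝ) 1) (hsum : ∑ k, a k = 1)
    (μ : Fin n → Measure X) (hμ : ∀ k, IsProbabilityMeasure (μ k))
    (hdim : ∀ k, ldimE (μ k) = udimE (μ k)) :
    ldimE (∑ k, ENNReal.ofReal (a k) • μ k) = udimE (∑ k, ENNReal.ofReal (a k) • μ k) ∧
    udimE (∑ k, ENNReal.ofReal (a k) • μ k) = ∑ k, ENNReal.ofReal (a k) * udimE (μ k) := by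
  have ha0 : ∀ k, 0 ≤ a k := fun k => (ha k).1
  have hk : ∀ k, Tendsto
      (fun δ : ℝ => entropyH (μ k) (ballFam X δ) / ENNReal.ofReal (-Real.logb 2 δ))
      (𝓝[>] 0) (𝓝 (udimE (μ k))) := fun k =>
    tendsto_of_liminf_eq_limsup (hdim k) rfl
  have hlow : Tendsto (fun δ : ℝ => ∑ k, ENNReal.ofReal (a k) *
      (entropyH (μ k) (ballFam X δ) / ENNReal.ofReal (-Real.logb 2 δ)))
      (𝓝[>] 0) (𝓝 (∑ k, ENNReal.ofReal (a k) * udimE (μ k))) :=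
    tendsto_finsetSum _ fun k _ =>
      ENNReal.Tendsto.const_mul (hk k) (Or.inr ENNReal.ofReal_ne_top)
  have hC : (2 + 2 * n : ℝ≥0∞) ≠ ⊤ := by finiteness
  have hup := hlow.add (tendsto_div_ofReal_neg_logb hC)
  rw [add_zero] at hup
  have hmix : Tendsto (fun δ : ℝ => entropyH (∑ k, ENNReal.ofReal (a k) • μ k) (ballFam X δ) /
      ENNReal.ofReal (-Real.logb 2 δ)) (𝓝[>] 0)
      (𝓝 (∑ k, ENNReal.ofReal (a k) * udimE (μ k))) := by
    refine tendsto_of_tendsto_of_tendsto_of_le_of_le hlow hup (fun δ => ?_) (fun δ => ?_)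
    · have := ENNReal.div_le_div_right (sum_mul_entropyH_le (μ := μ) ha0 hsum (ballFam X δ))
        (ENNReal.ofReal (-Real.logb 2 δ))
      simpa only [div_eq_mul_inv, Finset.sum_mul, mul_assoc] using this
    · have := ENNReal.div_le_div_right (entropyH_mixture_le (μ := μ) ha0 hsum (ballFam X δ))
        (ENNReal.ofReal (-Real.logb 2 δ))
      simpa only [div_eq_mul_inv, Finset.sum_mul, add_mul, mul_assoc] using this
  exact ⟨hmix.liminf_eq.trans hmix.limsup_eq.symm, hmix.limsup_eq⟩
end

section
/- Let X be a bounded metric space with Borel σ-algebra Σ and finite upper box dimension, udim_B(X) < ∞. Let (a_k)_{k=1}^∞ ⊆ [0,1] with Σ_{k=1}^∞ a_k = 1, and let (μ_k)_{k=1}^∞ be Borel probability measures on X. Then udim_E(Σ_{k=1}^∞ a_k μ_k) ≤ Σ_{k=1}^∞ a_k udim_E(μ_k). -/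
open MeasureTheory ENNReal

/-- The Gibbs inequality, for a single term and without subtraction. -/
lemma ofReal_sh_add_le {t q : ℝ≥0∞} (ht : t ≤ 1) (hq : q ≤ 1) (hpos : q = 0 → t = 0) :
    ENNReal.ofReal (sh t.toReal) + t * ENNReal.ofReal (Real.log 2)⁻¹ ≤
      t * ENNReal.ofReal (-Real.logb 2 q.toReal) + q * ENNReal.ofReal (Real.log 2)⁻¹ := by
  have htop : t ≠ ⊤ := (ht.trans_lt one_lt_top).ne
  have hqtop : q ≠ ⊤ := (hq.trans_lt one_lt_top).ne
  rcases eq_or_ne t 0 with rfl | ht0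
  · simp [sh]
  have hq0 : q ≠ 0 := fun h => ht0 (hpos h)
  lift t to NNReal using htop
  lift q to NNReal using hqtop
  have htp : (0 : ℝ) < t := by exact_mod_cast pos_iff_ne_zero.2 ht0
  have hqp : (0 : ℝ) < q := by exact_mod_cast pos_iff_ne_zero.2 hq0
  have ht1 : (t : ℝ) ≤ 1 := by exact_mod_cast ht
  have hq1 : (q : ℝ) ≤ 1 := by exact_mod_cast hq
  have hl2 : 0 < Real.log 2 := Real.log_pos one_lt_two
  have hsh : 0 ≤ sh t := by
    have := Real.logb_nonpos one_lt_two htp.le ht1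
    unfold sh; nlinarith
  have hc : 0 ≤ -Real.logb 2 (q : ℝ) := by
    have := Real.logb_nonpos one_lt_two hqp.le hq1
    linarith
  have hinv : 0 ≤ (Real.log 2)⁻¹ := by positivity
  have e1 : (t : ℝ≥0∞) = ENNReal.ofReal t := by simp
  have e2 : (q : ℝ≥0∞) = ENNReal.ofReal q := by simp
  simp only [ENNReal.coe_toReal]
  rw [e1, e2, ← ENNReal.ofReal_mul htp.le, ← ENNReal.ofReal_mul htp.le,
    ← ENNReal.ofReal_mul hqp.le, ← ENNReal.ofReal_add hsh (by positivity),
    ← ENNReal.ofReal_add (by positivity) (by positivity)]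
  apply ENNReal.ofReal_le_ofReal
  have key := Real.log_le_sub_one_of_pos (div_pos hqp htp)
  rw [Real.log_div hqp.ne' htp.ne'] at key
  have key2 : (t : ℝ) * (Real.log q - Real.log t) ≤ q - t := by
    calc (t : ℝ) * (Real.log q - Real.log t) ≤ t * (q / t - 1) := by gcongr
      _ = q - t := by field_simp
  simp only [sh, Real.logb, div_eq_mul_inv]
  nlinarith [mul_le_mul_of_nonneg_right key2 hinv]

/-- Greedy disjointification: given a countable cover `S` whose members carry weights `q`
of total mass at most one, assigning every point to a member of largest weight containing it gives
a partition whose entropy, for any probability measure, is at most the mean code length. -/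
lemma exists_codeLength {X I : Type*} [MeasurableSpace X] [Countable I]
    {S : I → Set X} (hS : ∀ i, MeasurableSet (S i)) {q : I → ℝ≥0∞} (hq : ∑' i, q i ≤ 1)
    (hcov : ∀ x, ∃ i, x ∈ S i ∧ q i ≠ 0) :
    ∃ g : X → ℝ≥0∞,
      (∀ i x, x ∈ S i → q i ≠ 0 → g x ≤ ENNReal.ofReal (-Real.logb 2 (q i).toReal)) ∧
      ∀ (ν : Measure X) [IsProbabilityMeasure ν] (Q : Set (Set X)),
        (∀ i, ∃ B ∈ Q, S i ⊆ B) → entropyH ν Q ≤ ∫⁻ x, g x ∂ν := by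
  obtain ⟨e, he⟩ := Countable.exists_injective_nat I
  have hq1 : ∀ i, q i ≤ 1 := fun i => (ENNReal.le_tsum i).trans hq
  let f : I → Lex (ℝ≥0∞ᵒᵈ × ℕ) := fun i => toLex (OrderDual.toDual (q i), e i)
  have hf : Function.Injective f := fun i j h => by
    have := congrArg (fun z => (ofLex z).2) h
    exact he this
  have hfq : ∀ i j, f i ≤ f j → q j ≤ q i := fun i j h => by
    rw [Prod.Lex.le_iff] at h
    rcases h with h | h
    · exact le_of_lt h
    · exact le_of_eq (congrArg OrderDual.ofDual h.1).symm
  let R : I → Set X := fun i => S i ∩ ⋂ j, {x | x ∈ S j → f i ≤ f j}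
  have hRm : ∀ i, MeasurableSet (R i) := fun i => by
    refine (hS i).inter (MeasurableSet.iInter fun j => ?_)
    by_cases h : f i ≤ f j
    · simp [h]
    · simp only [h, imp_false]
      exact (hS j).compl
  have hRle : ∀ {i j x}, x ∈ R i → x ∈ S j → f i ≤ f j := fun {i j x} hx hj =>
    Set.mem_iInter.1 hx.2 j hj
  have hRdisj : Pairwise (Function.onFun Disjoint R) := fun i j hij => by
    refine Set.disjoint_left.2 fun x hi hj => hij (hf ?_)
    exact le_antisymm (hRle hi hj.1) (hRle hj hi.1)
  have hRcov : ∀ x, ∃ i, x ∈ R i := fun x => by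
    obtain ⟨i₀, hi₀, hq₀⟩ := hcov x
    have hfin : {i | x ∈ S i ∧ q i₀ ≤ q i}.Finite :=
      (ENNReal.finite_const_le_of_tsum_ne_top (hq.trans_lt one_lt_top).ne hq₀).subset
        fun i hi => hi.2
    obtain ⟨i, hi, hmin⟩ := Set.exists_min_image _ f hfin ⟨i₀, hi₀, le_rfl⟩
    refine ⟨i, hi.1, Set.mem_iInter.2 fun j hj => ?_⟩
    by_cases h : q i₀ ≤ q j
    · exact hmin j ⟨hj, h⟩
    · refine le_of_lt (Prod.Lex.lt_iff.2 (Or.inl ?_))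
      exact OrderDual.toDual_lt_toDual.2 (lt_of_lt_of_le (not_le.1 h) hi.2)
  have hRzero : ∀ i, q i = 0 → R i = ∅ := fun i hi => by
    refine Set.eq_empty_of_forall_notMem fun x hx => ?_
    obtain ⟨j, hj, hqj⟩ := hcov x
    exact hqj (le_antisymm (hi ▸ hfq _ _ (hRle hx hj)) bot_le)
  let c : I → ℝ≥0∞ := fun i => ENNReal.ofReal (-Real.logb 2 (q i).toReal)
  have hg : ∀ {i x}, x ∈ R i → ∑' j, (R j).indicator (fun _ => c j) x = c i := fun {i x} hx => by
    rw [tsum_eq_single i]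
    · simp [hx]
    · intro j hj
      exact Set.indicator_of_notMem (fun h => Set.disjoint_left.1 (hRdisj hj) h hx) _
  refine ⟨fun x => ∑' j, (R j).indicator (fun _ => c j) x, fun i x hx hqi => ?_,
    fun ν _ Q hQ => ?_⟩
  · obtain ⟨j, hj⟩ := hRcov x
    have hle := hfq _ _ (hRle hj hx)
    simp only [hg hj]
    apply ENNReal.ofReal_le_ofReal
    have h0 : 0 < (q i).toReal := ENNReal.toReal_pos hqi ((hq1 i).trans_lt one_lt_top).ne
    have := Real.logb_le_logb_of_le one_lt_two h0
      (ENNReal.toReal_mono ((hq1 j).trans_lt one_lt_top).ne hle)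
    linarith
  · have hUnion : ⋃ i, R i = Set.univ := Set.eq_univ_of_forall fun x => Set.mem_iUnion.2 (hRcov x)
    have hsum : ∑' i, ν (R i) = 1 := by
      rw [← measure_iUnion hRdisj hRm, hUnion, measure_univ]
    have hpart : IsMuPartition ν (Set.range R) := by
      refine ⟨Set.countable_range R, ?_, ?_, ?_⟩
      · rintro _ ⟨i, rfl⟩
        exact hRm i
      · rintro _ ⟨i, rfl⟩ _ ⟨j, rfl⟩ hne
        exact hRdisj fun h => hne (h ▸ rfl)
      · simp [Set.sUnion_range, hUnion]
    have hfiner : Finer (Set.range R) Q := by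
      rintro _ ⟨i, rfl⟩
      obtain ⟨B, hB, hSB⟩ := hQ i
      exact ⟨B, hB, Set.inter_subset_left.trans hSB⟩
    have hgibbs : ∑' i, ENNReal.ofReal (sh (ν (R i)).toReal) ≤ ∑' i, ν (R i) * c i := by
      set b := ENNReal.ofReal (Real.log 2)⁻¹
      have hterm := ENNReal.tsum_le_tsum fun i =>
        ofReal_sh_add_le (prob_le_one (μ := ν) (s := R i)) (hq1 i) fun h => by simp [hRzero i h]
      rw [ENNReal.tsum_add, ENNReal.tsum_add, ENNReal.tsum_mul_right, ENNReal.tsum_mul_right,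
        hsum] at hterm
      refine (ENNReal.add_le_add_iff_right (a := 1 * b) (by simp [b])).1 (hterm.trans ?_)
      gcongr
    calc entropyH ν Q ≤ partEntropy ν (Set.range R) :=
          iInf_le_of_le _ (iInf_le_of_le hpart (iInf_le _ hfiner))
      _ ≤ ∑' i, ENNReal.ofReal (sh (ν (R i)).toReal) :=
          ENNReal.tsum_le_tsum_comp_of_surjective (f := Set.rangeFactorization R)
            Set.rangeFactorization_surjective fun s => ENNReal.ofReal (sh (ν s).toReal)
      _ ≤ ∑' i, ν (R i) * c i := hgibbs
      _ = ∫⁻ x, ∑' j, (R j).indicator (fun _ => c j) x ∂ν := by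
          rw [lintegral_tsum fun i => (measurable_const.indicator (hRm i)).aemeasurable]
          exact tsum_congr fun i => by rw [lintegral_indicator_const (hRm i), mul_comm]

lemma lintegral_le_partEntropy_add {X : Type*} [MeasurableSpace X] (μ : Measure X)
    [IsProbabilityMeasure μ] {P : Set (Set X)} (hP : IsMuPartition μ P) {g : X → ℝ≥0∞} {l : ℝ≥0∞}
    (hg : ∀ p ∈ P, μ p ≠ 0 → ∀ x ∈ p, g x ≤ ENNReal.ofReal (-Real.logb 2 (μ p).toReal) + l) :
    ∫⁻ x, g x ∂μ ≤ partEntropy μ P + l := by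
  obtain ⟨hcount, hmeas, hdisj, hnull⟩ := hP
  have : Countable P := hcount.to_subtype
  have hmass : ∑' p : P, μ p ≤ 1 := by
    rw [← measure_univ (μ := μ)]
    exact tsum_measure_le_measure_univ (fun p => (hmeas p p.2).nullMeasurableSet)
      fun p p' hne => (hdisj p.2 p'.2 fun h => hne (Subtype.ext h)).aedisjoint
  have hterm : ∀ p : P, ∫⁻ x in (p : Set X), g x ∂μ ≤
      ENNReal.ofReal (sh (μ p).toReal) + μ p * l := fun p => by
    rcases eq_or_ne (μ p) 0 with h0 | h0
    · simp [setLIntegral_measure_zero _ _ h0]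
    calc ∫⁻ x in (p : Set X), g x ∂μ
        ≤ ∫⁻ _ in (p : Set X), (ENNReal.ofReal (-Real.logb 2 (μ p).toReal) + l) ∂μ :=
          setLIntegral_mono' (hmeas p p.2) (hg p p.2 h0)
      _ = μ p * ENNReal.ofReal (-Real.logb 2 (μ p).toReal) + μ p * l := by
          rw [setLIntegral_const, mul_comm, mul_add]
      _ = ENNReal.ofReal (sh (μ p).toReal) + μ p * l := by
          conv_lhs => enter [1, 1]; rw [← ENNReal.ofReal_toReal (measure_ne_top μ p)]
          rw [← ENNReal.ofReal_mul ENNReal.toReal_nonneg, sh, mul_neg]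
  calc ∫⁻ x, g x ∂μ = ∫⁻ x in ⋃ p : P, (p : Set X), g x ∂μ := by
        rw [← Set.sUnion_eq_iUnion, Measure.restrict_eq_self_of_ae_mem]
        exact mem_ae_iff.2 hnull
    _ ≤ ∑' p : P, ∫⁻ x in (p : Set X), g x ∂μ := lintegral_iUnion_le _ _
    _ ≤ ∑' p : P, (ENNReal.ofReal (sh (μ p).toReal) + μ p * l) := ENNReal.tsum_le_tsum hterm
    _ = partEntropy μ P + (∑' p : P, μ p) * l := by
        rw [ENNReal.tsum_add, ENNReal.tsum_mul_right, partEntropy]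
    _ ≤ partEntropy μ P + l := by
        gcongr
        exact mul_le_of_le_one_left' hmass

lemma entropyH_ballFam_le_logb_card {X : Type*} [MetricSpace X] [MeasurableSpace X] [BorelSpace X]
    [Nonempty X] (μ : Measure X) [IsProbabilityMeasure μ] {δ : ℝ} {t : Finset X}
    (ht : Set.univ ⊆ ⋃ x ∈ t, Metric.closedBall x δ) :
    entropyH μ (ballFam X δ) ≤ ENNReal.ofReal (Real.logb 2 t.card) := by
  have hne : t.Nonempty := by
    obtain ⟨x, hx, -⟩ := Set.mem_iUnion₂.1 (ht (Set.mem_univ (Classical.arbitrary X)))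
    exact ⟨x, hx⟩
  obtain ⟨g, hg, hH⟩ := exists_codeLength (I := t) (S := fun x => Metric.closedBall x.1 δ)
    (fun _ => measurableSet_closedBall) (q := fun _ => (t.card : ℝ≥0∞)⁻¹)
    (by
      simp only [tsum_fintype, Finset.sum_const, Finset.card_univ, Fintype.card_coe, nsmul_eq_mul]
      exact ENNReal.mul_inv_le_one _)
    (fun x => by
      obtain ⟨y, hy, hxy⟩ := Set.mem_iUnion₂.1 (ht (Set.mem_univ x))
      exact ⟨⟨y, hy⟩, hxy, by simp⟩)
  calc entropyH μ (ballFam X δ) ≤ ∫⁻ x, g x ∂μ := hH μ _ fun x => ⟨_, ⟨x.1, rfl⟩, le_rfl⟩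
    _ ≤ ∫⁻ _, ENNReal.ofReal (Real.logb 2 t.card) ∂μ := by
        refine lintegral_mono fun x => ?_
        obtain ⟨y, hy, hxy⟩ := Set.mem_iUnion₂.1 (ht (Set.mem_univ x))
        simpa using hg ⟨y, hy⟩ x hxy (by simp)
    _ = ENNReal.ofReal (Real.logb 2 t.card) := by simp

lemma ofReal_neg_logb_mul_inv {m : ℝ≥0∞} (hm0 : m ≠ 0) (hm1 : m ≤ 1) (n : ℕ) :
    ENNReal.ofReal (-Real.logb 2 (m * ((n + 1 : ℕ) : ℝ≥0∞)⁻¹).toReal) =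
      ENNReal.ofReal (-Real.logb 2 m.toReal) + ENNReal.ofReal (Real.logb 2 (n + 1 : ℕ)) := by
  have hmtop : m ≠ ⊤ := (hm1.trans_lt one_lt_top).ne
  have hm : 0 < m.toReal := ENNReal.toReal_pos hm0 hmtop
  have hm1' : m.toReal ≤ 1 := by simpa using ENNReal.toReal_mono one_ne_top hm1
  rw [← ENNReal.ofReal_add]
  · rw [ENNReal.toReal_mul, ENNReal.toReal_inv, ENNReal.toReal_natCast,
      Real.logb_mul hm.ne' (by positivity), Real.logb_inv]
    ring_nf
  · have := Real.logb_nonpos one_lt_two hm.le hm1'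
    linarith
  · exact Real.logb_nonneg one_lt_two (by norm_cast; omega)

/-- Entropy bound for a countable mixture: the first `n` components are encoded with prescribed
partitions, and the tail with a finite cover by balls. -/
lemma entropyH_mixture_le_partEntropy_s14 {X : Type*} [MetricSpace X] [MeasurableSpace X]
    [BorelSpace X] {w : ℕ → ℝ≥0∞} (hw : ∑' k, w k = 1)
    (μ : ℕ → Measure X) [∀ k, IsProbabilityMeasure (μ k)] {δ : ℝ} {t : Finset X}
    (ht : Set.univ ⊆ ⋃ x ∈ t, Metric.closedBall x δ) (n : ℕ) {P : Fin n → Set (Set X)}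
    (hP : ∀ k : Fin n, IsMuPartition (μ k) (P k)) (hPfine : ∀ k, Finer (P k) (ballFam X δ)) :
    entropyH (Measure.sum fun k => w k • μ k) (ballFam X δ) ≤
      ∑ k : Fin n, w k * partEntropy (μ k) (P k) +
        (∑' k, w (k + n)) * ENNReal.ofReal (Real.logb 2 t.card) +
        ENNReal.ofReal (Real.logb 2 (n + 1 : ℕ)) := by
  have : ∀ k, Countable (P k) := fun k => (hP k).1.to_subtype
  set d : ℝ≥0∞ := ((n + 1 : ℕ) : ℝ≥0∞)⁻¹ with hd
  set l := ENNReal.ofReal (Real.logb 2 (n + 1 : ℕ)) with hl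
  have hd0 : d ≠ 0 := ENNReal.inv_ne_zero.2 (ENNReal.natCast_ne_top _)
  let S : (Σ k : Fin n, P k) ⊕ t → Set X :=
    Sum.elim (fun i => (i.2 : Set X)) fun x => Metric.closedBall x.1 δ
  let q : (Σ k : Fin n, P k) ⊕ t → ℝ≥0∞ :=
    Sum.elim (fun i => μ i.1 (i.2 : Set X) * d) fun _ => (t.card : ℝ≥0∞)⁻¹ * d
  have hball0 : (t.card : ℝ≥0∞)⁻¹ ≠ 0 := ENNReal.inv_ne_zero.2 (ENNReal.natCast_ne_top _)
  have hqsum : ∑' i, q i ≤ 1 := by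
    rw [Summable.tsum_sum ENNReal.summable ENNReal.summable]
    have h1 : ∑' i : Σ k : Fin n, P k, q (Sum.inl i) ≤ n * d := by
      calc ∑' i : Σ k : Fin n, P k, q (Sum.inl i)
          = ∑' (k : Fin n) (p : P k), μ k (p : Set X) * d :=
            ENNReal.tsum_sigma fun (k : Fin n) (p : P k) => μ k (p : Set X) * d
        _ ≤ ∑' _ : Fin n, d := by
            refine ENNReal.tsum_le_tsum fun k => ?_
            rw [ENNReal.tsum_mul_right]
            refine mul_le_of_le_one_left' ?_
            rw [← measure_univ (μ := μ k)]
            exact tsum_measure_le_measure_univ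
              (fun p => ((hP k).2.1 p p.2).nullMeasurableSet)
              fun p p' hne => ((hP k).2.2.1 p.2 p'.2 fun h => hne (Subtype.ext h)).aedisjoint
        _ = n * d := by simp [tsum_fintype]
    have h2 : ∑' x : t, q (Sum.inr x) ≤ d := by
      simp only [q, Sum.elim_inr, tsum_fintype, Finset.sum_const, Finset.card_univ,
        Fintype.card_coe, nsmul_eq_mul]
      rw [← mul_assoc]
      exact mul_le_of_le_one_left' (ENNReal.mul_inv_le_one _)
    calc _ ≤ n * d + d := add_le_add h1 h2
      _ = ((n + 1 : ℕ) : ℝ≥0∞) * d := by push_cast; ring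
      _ ≤ 1 := ENNReal.mul_inv_le_one _
  have hcov : ∀ x, ∃ i, x ∈ S i ∧ q i ≠ 0 := fun x => by
    obtain ⟨y, hy, hxy⟩ := Set.mem_iUnion₂.1 (ht (Set.mem_univ x))
    exact ⟨Sum.inr ⟨y, hy⟩, hxy, mul_ne_zero hball0 hd0⟩
  obtain ⟨g, hg, hH⟩ := exists_codeLength (S := S) (fun i => by
    rcases i with i | x
    · exact (hP i.1).2.1 i.2 i.2.2
    · exact measurableSet_closedBall) hqsum hcov
  have hhead : ∀ k : Fin n, ∫⁻ x, g x ∂(μ k) ≤ partEntropy (μ k) (P k) + l := fun k => by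
    refine lintegral_le_partEntropy_add (μ k) (hP k) fun p hp h0 x hx => ?_
    rw [hl, ← ofReal_neg_logb_mul_inv h0 prob_le_one]
    exact hg (Sum.inl ⟨k, p, hp⟩) x hx (mul_ne_zero h0 hd0)
  have htail : ∀ k, ∫⁻ x, g x ∂(μ k) ≤ ENNReal.ofReal (Real.logb 2 t.card) + l := fun k => by
    calc ∫⁻ x, g x ∂(μ k) ≤ ∫⁻ _, (ENNReal.ofReal (Real.logb 2 t.card) + l) ∂(μ k) := by
          refine lintegral_mono fun x => ?_
          obtain ⟨y, hy, hxy⟩ := Set.mem_iUnion₂.1 (ht (Set.mem_univ x))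
          have hcard : (1 : ℝ≥0∞) ≤ t.card := by
            exact_mod_cast Finset.card_pos.2 ⟨y, hy⟩
          have := hg (Sum.inr ⟨y, hy⟩) x hxy (mul_ne_zero hball0 hd0)
          simp only [q, Sum.elim_inr] at this
          rw [ofReal_neg_logb_mul_inv hball0 (ENNReal.inv_le_one.2 hcard)] at this
          simpa [hl] using this
      _ = _ := by simp
  have : IsProbabilityMeasure (Measure.sum fun k => w k • μ k) := ⟨by simp [hw]⟩
  calc entropyH (Measure.sum fun k => w k • μ k) (ballFam X δ)
      ≤ ∫⁻ x, g x ∂(Measure.sum fun k => w k • μ k) := by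
        refine hH _ _ fun i => ?_
        rcases i with i | x
        · exact hPfine i.1 i.2 i.2.2
        · exact ⟨_, ⟨x.1, rfl⟩, le_rfl⟩
    _ = ∑' k, w k * ∫⁻ x, g x ∂(μ k) := by
        simp [lintegral_sum_measure, lintegral_smul_measure]
    _ = ∑ k ∈ Finset.range n, w k * ∫⁻ x, g x ∂(μ k) +
          ∑' k, w (k + n) * ∫⁻ x, g x ∂(μ (k + n)) :=
        (ENNReal.summable.sum_add_tsum_nat_add' (f := fun k => w k * ∫⁻ x, g x ∂(μ k))).symm
    _ ≤ ∑ k : Fin n, w k * (partEntropy (μ k) (P k) + l) +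
          ∑' k, w (k + n) * (ENNReal.ofReal (Real.logb 2 t.card) + l) := by
        rw [← Fin.sum_univ_eq_sum_range fun k => w k * ∫⁻ x, g x ∂(μ k)]
        gcongr with k _ k
        · exact hhead k
        · exact htail _
    _ = ∑ k : Fin n, w k * partEntropy (μ k) (P k) +
          (∑' k, w (k + n)) * ENNReal.ofReal (Real.logb 2 t.card) +
          (∑ k ∈ Finset.range n, w k + ∑' k, w (k + n)) * l := by
        simp only [mul_add, Finset.sum_add_distrib, ENNReal.tsum_add, ENNReal.tsum_mul_right,
          ← Finset.sum_mul, add_mul, Fin.sum_univ_eq_sum_range]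
        ring
    _ = _ := by
        rw [ENNReal.summable.sum_add_tsum_nat_add' (f := w), hw, one_mul]

lemma entropyH_mixture_le_s14 {X : Type*} [MetricSpace X] [MeasurableSpace X]
    [BorelSpace X] {w : ℕ → ℝ≥0∞} (hw : ∑' k, w k = 1)
    (μ : ℕ → Measure X) [∀ k, IsProbabilityMeasure (μ k)] {δ : ℝ} {t : Finset X}
    (ht : Set.univ ⊆ ⋃ x ∈ t, Metric.closedBall x δ) (n : ℕ) :
    entropyH (Measure.sum fun k => w k • μ k) (ballFam X δ) ≤
      ∑ k ∈ Finset.range n, w k * entropyH (μ k) (ballFam X δ) +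
        (∑' k, w (k + n)) * ENNReal.ofReal (Real.logb 2 t.card) +
        ENNReal.ofReal (Real.logb 2 (n + 1 : ℕ)) := by
  have : Nonempty X := nonempty_of_isProbabilityMeasure (μ 0)
  refine ENNReal.le_of_forall_pos_le_add fun ε hε _ => ?_
  have hex : ∀ k : Fin n, ∃ P, IsMuPartition (μ k) P ∧ Finer P (ballFam X δ) ∧
      partEntropy (μ k) P ≤ entropyH (μ k) (ballFam X δ) + ε := fun k => by
    have hfin : entropyH (μ k) (ballFam X δ) ≠ ⊤ :=
      ((entropyH_ballFam_le_logb_card (μ k) ht).trans_lt ENNReal.ofReal_lt_top).ne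
    have hlt := ENNReal.lt_add_right hfin (ENNReal.coe_ne_zero.2 hε.ne')
    conv_lhs at hlt => rw [entropyH]
    simp only [iInf_lt_iff] at hlt
    obtain ⟨P, hP, hf, hlt⟩ := hlt
    exact ⟨P, hP, hf, hlt.le⟩
  choose P hP hPfine hPle using hex
  have hsum : ∑ k ∈ Finset.range n, w k ≤ 1 := hw ▸ ENNReal.sum_le_tsum _
  calc _ ≤ _ := entropyH_mixture_le_partEntropy_s14 hw μ ht n hP hPfine
    _ ≤ ∑ k : Fin n, w k * (entropyH (μ k) (ballFam X δ) + ε) +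
          (∑' k, w (k + n)) * ENNReal.ofReal (Real.logb 2 t.card) +
          ENNReal.ofReal (Real.logb 2 (n + 1 : ℕ)) := by
        gcongr with k
        exact hPle k
    _ = ∑ k ∈ Finset.range n, w k * entropyH (μ k) (ballFam X δ) +
          (∑' k, w (k + n)) * ENNReal.ofReal (Real.logb 2 t.card) +
          ENNReal.ofReal (Real.logb 2 (n + 1 : ℕ)) + (∑ k ∈ Finset.range n, w k) * ε := by
        rw [Fin.sum_univ_eq_sum_range fun k => w k * (entropyH (μ k) (ballFam X δ) + ε)]
        simp only [mul_add, Finset.sum_add_distrib, ← Finset.sum_mul]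
        ring
    _ ≤ _ := by
        gcongr
        exact mul_le_of_le_one_left' hsum

lemma exists_finset_card_eq_coverNum {X : Type*} [PseudoMetricSpace X] {S : Set X} {δ : ℝ}
    (h : coverNum S δ ≠ ⊤) :
    ∃ t : Finset X, S ⊆ ⋃ x ∈ t, Metric.closedBall x δ ∧ (t.card : ℝ≥0∞) = coverNum S δ := by
  have hne : {m : ℕ | ∃ t : Finset X,
      S ⊆ ⋃ x ∈ t, Metric.closedBall x δ ∧ t.card = m}.Nonempty := by
    by_contra hempty
    refine h (iInf₂_eq_top.2 fun t ht => ?_)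
    exact (hempty ⟨t.card, t, ht, rfl⟩).elim
  obtain ⟨t, ht, hcard⟩ := Nat.sInf_mem hne
  refine ⟨t, ht, le_antisymm (le_iInf₂ fun t' ht' => ?_) (iInf₂_le t ht)⟩
  rw [hcard, Nat.cast_le]
  exact Nat.sInf_le ⟨t', ht', rfl⟩

lemma eventually_exists_cover {X : Type*} [PseudoMetricSpace X] {S : Set X} {D : ℝ≥0∞}
    (hD : ubdimB S < D) :
    ∀ᶠ δ : ℝ in nhdsWithin 0 (Set.Ioi 0), ∃ t : Finset X, S ⊆ ⋃ x ∈ t, Metric.closedBall x δ ∧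
      ENNReal.ofReal (Real.logb 2 t.card) ≤ D * ENNReal.ofReal (-Real.logb 2 δ) := by
  filter_upwards [Filter.eventually_lt_of_limsup_lt hD, Ioo_mem_nhdsGT one_pos] with δ hδ hδ1
  have hlog : 0 < -Real.log δ := neg_pos.2 (Real.log_neg hδ1.1 hδ1.2)
  have hl0 : ENNReal.ofReal (-Real.log δ) ≠ 0 := (ENNReal.ofReal_pos.2 hlog).ne'
  have htop : coverNum S δ ≠ ⊤ := fun h => by
    simp [h, logENN, ENNReal.top_div] at hδ
  obtain ⟨t, ht, hcard⟩ := exists_finset_card_eq_coverNum htop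
  refine ⟨t, ht, ?_⟩
  rw [ENNReal.div_lt_iff (Or.inl hl0) (Or.inl ENNReal.ofReal_ne_top), logENN, if_neg htop,
    ← hcard, ENNReal.toReal_natCast] at hδ
  have hl2 : (0 : ℝ) ≤ (Real.log 2)⁻¹ := inv_nonneg.2 (Real.log_nonneg one_le_two)
  have hN := mul_le_mul_left hδ.le (ENNReal.ofReal (Real.log 2)⁻¹)
  rw [mul_assoc, ← ENNReal.ofReal_mul' hl2, ← ENNReal.ofReal_mul' hl2] at hN
  simpa [Real.logb, div_eq_mul_inv] using hN

/-- Upper entropy dimension of a mixture, up to the contribution of its tail. -/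
lemma udimE_mixture_le_add_tail {X : Type*} [MetricSpace X] [MeasurableSpace X] [BorelSpace X]
    {D : ℝ≥0∞} (hD : ubdimB (Set.univ : Set X) < D) {w : ℕ → ℝ≥0∞} (hw : ∑' k, w k = 1)
    (μ : ℕ → Measure X) [∀ k, IsProbabilityMeasure (μ k)] (n : ℕ) :
    udimE (Measure.sum fun k => w k • μ k) ≤
      ∑' k, w k * udimE (μ k) + (∑' k, w (k + n)) * D := by
  refine ENNReal.le_of_forall_pos_le_add fun ε hε _ => ?_
  have hε2 : (ε / 2 : ℝ≥0∞) ≠ 0 := by simpa using hε.ne'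
  have hw1 : ∑ k ∈ Finset.range n, w k ≤ 1 := hw ▸ ENNReal.sum_le_tsum _
  have hcomp : ∀ k ∈ Finset.range n, ∀ᶠ δ : ℝ in nhdsWithin 0 (Set.Ioi 0),
      entropyH (μ k) (ballFam X δ) / ENNReal.ofReal (-Real.logb 2 δ) ≤
        udimE (μ k) + (ε / 2 : ℝ≥0∞) := fun k _ => by
    rcases eq_or_ne (udimE (μ k)) ⊤ with h | h
    · simp [h]
    · exact (Filter.eventually_lt_of_limsup_lt (ENNReal.lt_add_right h hε2)).mono
        fun _ h => h.le
  have hscale : Filter.Tendsto (fun δ : ℝ => ENNReal.ofReal (-Real.logb 2 δ))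
      (nhdsWithin 0 (Set.Ioi 0)) (nhds ⊤) := by
    refine ENNReal.tendsto_ofReal_atTop.comp (Filter.tendsto_neg_atBot_atTop.comp ?_)
    exact Real.tendsto_logb_nhdsGT_zero one_lt_two
  have hover : ∀ᶠ δ : ℝ in nhdsWithin 0 (Set.Ioi 0),
      ENNReal.ofReal (Real.logb 2 (n + 1 : ℕ)) / ENNReal.ofReal (-Real.logb 2 δ) <
        (ε / 2 : ℝ≥0∞) := by
    have := ENNReal.Tendsto.const_div (a := ENNReal.ofReal (Real.logb 2 (n + 1 : ℕ))) hscale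
      (Or.inr ENNReal.ofReal_ne_top)
    rw [ENNReal.div_top] at this
    exact this.eventually_lt_const (pos_iff_ne_zero.2 hε2)
  refine Filter.limsup_le_of_le (h := ?_)
  filter_upwards [(Filter.eventually_all_finset _).2 hcomp, hover, eventually_exists_cover hD,
    Ioo_mem_nhdsGT one_pos] with δ hk hδ ⟨t, ht, hcard⟩ hδ1
  set L := ENNReal.ofReal (-Real.logb 2 δ)
  have hL0 : L ≠ 0 :=
    (ENNReal.ofReal_pos.2 (neg_pos.2 (Real.logb_neg one_lt_two hδ1.1 hδ1.2))).ne'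
  calc entropyH (Measure.sum fun k => w k • μ k) (ballFam X δ) / L
      ≤ (∑ k ∈ Finset.range n, w k * entropyH (μ k) (ballFam X δ) +
          (∑' k, w (k + n)) * (D * L) + ENNReal.ofReal (Real.logb 2 (n + 1 : ℕ))) / L := by
        refine ENNReal.div_le_div_right ((entropyH_mixture_le_s14 hw μ ht n).trans ?_) L
        gcongr
    _ = ∑ k ∈ Finset.range n, w k * (entropyH (μ k) (ballFam X δ) / L) +
          (∑' k, w (k + n)) * D + ENNReal.ofReal (Real.logb 2 (n + 1 : ℕ)) / L := by
        rw [ENNReal.add_div, ENNReal.add_div, ← mul_assoc,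
          ENNReal.mul_div_cancel_right hL0 ENNReal.ofReal_ne_top]
        simp only [div_eq_mul_inv, Finset.sum_mul, mul_assoc]
    _ ≤ ∑ k ∈ Finset.range n, w k * (udimE (μ k) + (ε / 2 : ℝ≥0∞)) +
          (∑' k, w (k + n)) * D + (ε / 2 : ℝ≥0∞) := by
        gcongr with k hk'
        exact hk k hk'
    _ = ∑ k ∈ Finset.range n, w k * udimE (μ k) + (∑' k, w (k + n)) * D +
          ((∑ k ∈ Finset.range n, w k) * (ε / 2 : ℝ≥0∞) + (ε / 2 : ℝ≥0∞)) := by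
        simp only [mul_add, Finset.sum_add_distrib, ← Finset.sum_mul]
        ring
    _ ≤ ∑' k, w k * udimE (μ k) + (∑' k, w (k + n)) * D +
          ((ε / 2 : ℝ≥0∞) + (ε / 2 : ℝ≥0∞)) := by
        gcongr
        · exact ENNReal.sum_le_tsum _
        · exact mul_le_of_le_one_left' hw1
    _ = _ := by rw [ENNReal.add_halves]

/-- second inequality of Theorem 4 of the paper: if `X` is bounded with
finite upper box dimension, then for a countable mixture,
`udim_E(Σ_{k} a_k μ_k) ≤ Σ_{k} a_k udim_E(μ_k)`. -/
theorem udimE_countable_mixture_le {X : Type*} [MetricSpace X] [MeasurableSpace X] [BorelSpace X]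
    (hbdd : Bornology.IsBounded (Set.univ : Set X))
    (hbox : ubdimB (Set.univ : Set X) < ⊤)
    (a : ℕ → ℝ) (ha : ∀ k, a k ∈ Set.Icc (0 : ℝ) 1) (hsum : ∑' k, a k = 1)
    (μ : ℕ → Measure X) (hμ : ∀ k, IsProbabilityMeasure (μ k)) :
    udimE (Measure.sum (fun k => ENNReal.ofReal (a k) • μ k)) ≤
      ∑' k, ENNReal.ofReal (a k) * udimE (μ k) := by
  obtain ⟨D, hD, hDtop⟩ := exists_between hbox
  have hsummable : Summable a := by
    by_contra h
    simp [tsum_eq_zero_of_not_summable h] at hsum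
  have hw : ∑' k, ENNReal.ofReal (a k) = 1 := by
    rw [← ENNReal.ofReal_tsum_of_nonneg (fun k => (ha k).1) hsummable, hsum, ENNReal.ofReal_one]
  have htail : Filter.Tendsto (fun n => ∑' k, ENNReal.ofReal (a k) * udimE (μ k) +
      (∑' k, ENNReal.ofReal (a (k + n))) * D) Filter.atTop
      (nhds (∑' k, ENNReal.ofReal (a k) * udimE (μ k) + 0 * D)) :=
    tendsto_const_nhds.add (ENNReal.Tendsto.mul_const
      (ENNReal.tendsto_sum_nat_add (fun k => ENNReal.ofReal (a k)) (by simp [hw]))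
      (Or.inr hDtop.ne))
  rw [zero_mul, add_zero] at htail
  exact ge_of_tendsto' htail fun n => udimE_mixture_le_add_tail hD hw μ n
end

section
/- Let X be a bounded metric space with Borel σ-algebra and finite upper box dimension, udim_B(X) < ∞. Let (x_k)_{k=1}^∞ ⊆ X and (a_k)_{k=1}^∞ ⊆ [0,1] with Σ_{k=1}^∞ a_k = 1. Then the purely atomic probability measure Σ_{k=1}^∞ a_k δ_{x_k} has entropy dimension and dim_E(Σ_{k=1}^∞ a_k δ_{x_k}) = 0. -/
open MeasureTheory ENNReal

/-- The Gibbs inequality for a single term of the Shannon entropy. -/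
lemma sh_le_mul_log_add {p c : ℝ} (hp : 0 ≤ p) (hc : 0 < c) :
    sh p ≤ (p * Real.log c⁻¹ + c) / Real.log 2 := by
  have h2 : 0 < Real.log 2 := Real.log_pos one_lt_two
  rcases hp.eq_or_lt with rfl | hp
  · simp only [sh, zero_mul, neg_zero, zero_add]
    positivity
  have h := Real.log_le_sub_one_of_pos (div_pos hc hp)
  rw [Real.log_div hc.ne' hp.ne'] at h
  have h' := mul_le_mul_of_nonneg_left h hp.le
  have he : p * (c / p - 1) = c - p := by field_simp
  rw [he] at h'
  rw [sh, Real.logb, Real.log_inv, ← mul_div_assoc, ← neg_div]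
  gcongr
  linarith

lemma partEntropy_range_le_s15 {X ι : Type*} [MeasurableSpace X] [Fintype ι] (μ : Measure X)
    (f : ι → Set X) :
    partEntropy μ (Set.range f) ≤ ∑ i, ENNReal.ofReal (sh (μ (f i)).toReal) := by
  rw [← tsum_fintype (L := .unconditional _), partEntropy]
  have h := ENNReal.tsum_comp_le_tsum_of_injective (Set.rangeSplitting_injective f)
    (fun i => ENNReal.ofReal (sh (μ (f i)).toReal))
  simpa only [Set.apply_rangeSplitting] using h

/-- The entropy of `N` nonnegative weights of total mass at most `ε` is at most
`(ε log N + 1) / log 2`. -/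
lemma sum_sh_le {N : ℕ} (hN : 0 < N) (p : Fin N → ℝ) (hp : ∀ i, 0 ≤ p i) {ε : ℝ}
    (hε : ∑ i, p i ≤ ε) :
    ∑ i, ENNReal.ofReal (sh (p i)) ≤ ENNReal.ofReal ((ε * Real.log N + 1) / Real.log 2) := by
  have hN' : (0 : ℝ) < N := Nat.cast_pos.2 hN
  have hN1 : (1 : ℝ) ≤ N := Nat.one_le_cast.2 hN
  have hlog := Real.log_nonneg hN1
  have h2 : 0 < Real.log 2 := Real.log_pos one_lt_two
  calc ∑ i, ENNReal.ofReal (sh (p i))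
      ≤ ∑ i, ENNReal.ofReal ((p i * Real.log N + (N : ℝ)⁻¹) / Real.log 2) := by
        refine Finset.sum_le_sum fun i _ => ENNReal.ofReal_le_ofReal ?_
        simpa using sh_le_mul_log_add (hp i) (inv_pos.2 hN')
    _ = ENNReal.ofReal (∑ i, (p i * Real.log N + (N : ℝ)⁻¹) / Real.log 2) := by
        rw [ENNReal.ofReal_sum_of_nonneg]
        intro i _
        have := hp i
        positivity
    _ ≤ _ := by
        refine ENNReal.ofReal_le_ofReal ?_
        rw [← Finset.sum_div, Finset.sum_add_distrib, ← Finset.sum_mul]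
        simp only [Finset.sum_const, Finset.card_univ, Fintype.card_fin, nsmul_eq_mul]
        rw [mul_inv_cancel₀ hN'.ne']
        gcongr

/-- If all but mass `ε` of `μ` sits on a finite set `F`, and `X` is covered by the `δ`-balls
centred at `t`, then separating the points of `F` bounds the entropy at scale `δ`. -/
lemma entropyH_ballFam_le {X : Type*} [MetricSpace X] [MeasurableSpace X] [BorelSpace X]
    (μ : Measure X) [IsFiniteMeasure μ] (F : Finset X) {ε : ℝ} (hε : 0 ≤ ε)
    (hF : μ (F : Set X)ᶜ ≤ ENNReal.ofReal ε) {δ : ℝ} (hδ : 0 ≤ δ) (t : Finset X)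
    (ht : Set.univ ⊆ ⋃ x ∈ t, Metric.closedBall x δ) (htpos : 0 < t.card) :
    entropyH μ (ballFam X δ) ≤
      ENNReal.ofReal ((F.card + 1 + ε * Real.log t.card) / Real.log 2) := by
  have h2 : 0 < Real.log 2 := Real.log_pos one_lt_two
  set A : Fin t.card → Set X := fun i => Metric.closedBall (t.equivFin.symm i : X) δ with hA
  have hAcov : ⋃ i, A i = Set.univ := by
    refine Set.eq_univ_of_forall fun y => ?_
    obtain ⟨z, hz, hy⟩ := Set.mem_iUnion₂.1 (ht (Set.mem_univ y))
    exact Set.mem_iUnion.2 ⟨t.equivFin ⟨z, hz⟩, by simpa [hA] using hy⟩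
  have hDmeas : ∀ i, MeasurableSet (disjointed A i) := fun i =>
    disjointedRec (p := MeasurableSet)
      (fun _ _ h => h.diff Metric.isClosed_closedBall.measurableSet)
      Metric.isClosed_closedBall.measurableSet
  have hDdisj : Pairwise (Function.onFun Disjoint (disjointed A)) := disjoint_disjointed A
  let f : F ⊕ Fin t.card → Set X := Sum.elim (fun y => {(y : X)}) fun i => disjointed A i \ F
  have hfdisj : Pairwise (Function.onFun Disjoint f) := by
    rintro (y | i) (z | j) hne
    · have : (y : X) ≠ z := fun h => hne (congrArg _ (Subtype.ext h))
      simpa [Function.onFun, f] using this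
    · simp [Function.onFun, f]
    · simp [Function.onFun, f]
    · have hij : i ≠ j := fun h => hne (congrArg _ h)
      exact (hDdisj hij).mono Set.sdiff_subset Set.sdiff_subset
  have hfmeas : ∀ i, MeasurableSet (f i) := by
    rintro (y | i)
    · exact measurableSet_singleton _
    · exact (hDmeas i).diff F.measurableSet
  have hpart : IsMuPartition μ (Set.range f) := by
    refine ⟨Set.countable_range f, Set.forall_mem_range.2 hfmeas, ?_, ?_⟩
    · rintro _ ⟨i, rfl⟩ _ ⟨j, rfl⟩ hne
      exact hfdisj fun h => hne (congrArg f h)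
    · have : ⋃₀ Set.range f = Set.univ := by
        refine Set.eq_univ_of_forall fun y => ?_
        by_cases hy : y ∈ F
        · exact ⟨_, ⟨Sum.inl ⟨y, hy⟩, rfl⟩, rfl⟩
        · have : y ∈ ⋃ i, disjointed A i := by
            rw [iUnion_disjointed, hAcov]
            trivial
          obtain ⟨i, hi⟩ := Set.mem_iUnion.1 this
          exact ⟨_, ⟨Sum.inr i, rfl⟩, hi, hy⟩
      simp [this]
  have hfin : Finer (Set.range f) (ballFam X δ) := by
    rintro _ ⟨y | i, rfl⟩
    · exact ⟨_, ⟨y, rfl⟩, by simpa [f] using hδ⟩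
    · exact ⟨_, ⟨_, rfl⟩, Set.sdiff_subset.trans (disjointed_le A i)⟩
  have hmass : ∑ i, (μ (disjointed A i \ F)).toReal ≤ ε := by
    rw [← ENNReal.toReal_sum fun i _ => measure_ne_top _ _]
    refine ENNReal.toReal_le_of_le_ofReal hε (le_trans ?_ hF)
    rw [← tsum_fintype (L := .unconditional _), ← measure_iUnion
      (fun i j hij => (hDdisj hij).mono Set.sdiff_subset Set.sdiff_subset)
      fun i => (hDmeas i).diff F.measurableSet]
    exact measure_mono (Set.iUnion_subset fun i y hy => hy.2)
  have hatoms : ∑ y : F, ENNReal.ofReal (sh (μ (f (Sum.inl y))).toReal) ≤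
      ENNReal.ofReal (F.card / Real.log 2) := by
    calc ∑ y : F, ENNReal.ofReal (sh (μ (f (Sum.inl y))).toReal)
        ≤ ∑ _y : F, ENNReal.ofReal (1 / Real.log 2) := by
          refine Finset.sum_le_sum fun y _ => ENNReal.ofReal_le_ofReal ?_
          simpa using sh_le_mul_log_add (c := 1) ENNReal.toReal_nonneg one_pos
      _ = ENNReal.ofReal (F.card / Real.log 2) := by
          rw [← ENNReal.ofReal_sum_of_nonneg fun _ _ => by positivity]
          simp [div_eq_mul_inv]
  have hlog : 0 ≤ Real.log t.card := Real.log_natCast_nonneg _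
  calc entropyH μ (ballFam X δ) ≤ partEntropy μ (Set.range f) :=
        iInf_le_of_le _ (iInf_le_of_le hpart (iInf_le _ hfin))
    _ ≤ ∑ i, ENNReal.ofReal (sh (μ (f i)).toReal) := partEntropy_range_le_s15 μ f
    _ ≤ ENNReal.ofReal (F.card / Real.log 2) +
          ENNReal.ofReal ((ε * Real.log t.card + 1) / Real.log 2) := by
        rw [Fintype.sum_sum_type]
        exact add_le_add hatoms (sum_sh_le htpos _ (fun _ => ENNReal.toReal_nonneg) hmass)
    _ = _ := by
        rw [← ENNReal.ofReal_add (by positivity) (by positivity)]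
        congr 1
        ring

/-- A purely atomic finite measure is concentrated, up to mass `ε`, on finitely many points. -/
lemma exists_finset_measure_compl_le {X : Type*} [MetricSpace X] [MeasurableSpace X]
    [BorelSpace X] (x : ℕ → X) (c : ℕ → ℝ≥0∞)
    [IsFiniteMeasure (Measure.sum fun k => c k • Measure.dirac (x k))] {ε : ℝ≥0∞} (hε : 0 < ε) :
    ∃ F : Finset X, Measure.sum (fun k => c k • Measure.dirac (x k)) (F : Set X)ᶜ ≤ ε := by
  classical
  set μ := Measure.sum fun k => c k • Measure.dirac (x k) with hμ
  let F : ℕ → Finset X := fun n => (Finset.range n).image x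
  have hanti : Antitone fun n => ((F n : Set X))ᶜ := fun m n h =>
    Set.compl_subset_compl.2 (Finset.coe_subset.2
      (Finset.image_subset_image (Finset.range_mono h)))
  have hlim := tendsto_measure_iInter_atTop (μ := μ) (s := fun n => ((F n : Set X))ᶜ)
    (fun n => (F n).measurableSet.compl.nullMeasurableSet) hanti ⟨0, measure_ne_top _ _⟩
  have hzero : μ (⋂ n, ((F n : Set X))ᶜ) = 0 := by
    have hm : MeasurableSet (⋂ n, ((F n : Set X))ᶜ) :=
      MeasurableSet.iInter fun n => (F n).measurableSet.compl
    rw [hμ, Measure.sum_apply _ hm, ENNReal.tsum_eq_zero]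
    intro k
    have hk : x k ∉ ⋂ n, ((F n : Set X))ᶜ := fun h =>
      Set.mem_iInter.1 h (k + 1) (Finset.mem_coe.2
        (Finset.mem_image_of_mem x (Finset.mem_range.2 k.lt_succ_self)))
    rw [Measure.smul_apply, Measure.dirac_apply' _ hm, Set.indicator_of_notMem hk, smul_zero]
  rw [hzero] at hlim
  obtain ⟨n, hn⟩ := (hlim.eventually (gt_mem_nhds hε)).exists
  exact ⟨F n, hn.le⟩

/-- Finite upper box dimension gives covers of polynomial cardinality at all small scales. -/
lemma exists_eventually_cover_of_ubdimB_lt_top {X : Type*} [MetricSpace X] {S : Set X}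
    (h : ubdimB S < ⊤) :
    ∃ d : ℝ, 0 ≤ d ∧ ∀ᶠ δ in nhdsWithin (0 : ℝ) (Set.Ioi 0),
      ∃ t : Finset X, S ⊆ ⋃ x ∈ t, Metric.closedBall x δ ∧
        Real.log t.card ≤ 1 + d * -Real.log δ := by
  obtain ⟨d, hd, hdtop⟩ := exists_between h
  refine ⟨d.toReal, ENNReal.toReal_nonneg, ?_⟩
  have hlt : ∀ᶠ δ : ℝ in nhdsWithin 0 (Set.Ioi 0), δ < 1 :=
    nhdsWithin_le_nhds (gt_mem_nhds one_pos)
  filter_upwards [Filter.eventually_lt_of_limsup_lt hd, hlt, self_mem_nhdsWithin]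
    with δ hδ hδ1 hδ0
  have hL : 0 < -Real.log δ := neg_pos.2 (Real.log_neg hδ0 hδ1)
  have hdL : 0 ≤ d.toReal * -Real.log δ := mul_nonneg ENNReal.toReal_nonneg hL.le
  have hle : logENN (coverNum S δ) ≤ ENNReal.ofReal (d.toReal * -Real.log δ) := by
    rw [ENNReal.ofReal_mul ENNReal.toReal_nonneg, ENNReal.ofReal_toReal hdtop.ne]
    exact (ENNReal.div_le_iff (ENNReal.ofReal_pos.2 hL).ne' ENNReal.ofReal_ne_top).1 hδ.le
  have htop : coverNum S δ ≠ ⊤ := by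
    intro htop
    simp [logENN, htop] at hle
  rw [logENN, if_neg htop, ENNReal.ofReal_le_ofReal_iff hdL] at hle
  have hcov : (coverNum S δ).toReal ≤ Real.exp (d.toReal * -Real.log δ) := by
    rcases (ENNReal.toReal_nonneg (a := coverNum S δ)).eq_or_lt with h0 | h0
    · rw [← h0]
      positivity
    · exact (Real.log_le_iff_le_exp h0).1 hle
  have hlt : coverNum S δ < coverNum S δ + 1 := ENNReal.lt_add_right htop one_ne_zero
  obtain ⟨t, hlt⟩ := iInf_lt_iff.1 hlt
  obtain ⟨ht, hcard⟩ := iInf_lt_iff.1 hlt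
  refine ⟨t, ht, ?_⟩
  have hcard' : (t.card : ℝ) ≤ (coverNum S δ).toReal + 1 := by
    have := ENNReal.toReal_mono (ENNReal.add_ne_top.2 ⟨htop, one_ne_top⟩) hcard.le
    rwa [ENNReal.toReal_add htop one_ne_top, ENNReal.toReal_natCast, ENNReal.toReal_one] at this
  rcases t.card.eq_zero_or_pos with h0 | h0
  · rw [h0, Nat.cast_zero, Real.log_zero]
    positivity
  · rw [Real.log_le_iff_le_exp (Nat.cast_pos.2 h0), Real.exp_add]
    have h1 := Real.add_one_le_exp 1
    have h3 := Real.one_le_exp hdL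
    nlinarith

/-- Corollary 3 of the paper: if `X` is bounded with finite upper box
dimension, then every purely atomic probability measure `Σ_k a_k δ_{x_k}` has entropy
dimension equal to `0`. -/
theorem dimE_atomic_eq_zero {X : Type*} [MetricSpace X] [MeasurableSpace X] [BorelSpace X]
    (hbdd : Bornology.IsBounded (Set.univ : Set X))
    (hbox : ubdimB (Set.univ : Set X) < ⊤)
    (x : ℕ → X) (a : ℕ → ℝ) (ha : ∀ k, a k ∈ Set.Icc (0 : ℝ) 1) (hsum : ∑' k, a k = 1) :
    ldimE (Measure.sum (fun k => ENNReal.ofReal (a k) • Measure.dirac (x k))) = 0 ∧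
    udimE (Measure.sum (fun k => ENNReal.ofReal (a k) • Measure.dirac (x k))) = 0 := by
  have hsummable : Summable a := by
    by_contra h
    rw [tsum_eq_zero_of_not_summable h] at hsum
    exact zero_ne_one hsum
  have hfinite :
      IsFiniteMeasure (Measure.sum fun k => ENNReal.ofReal (a k) • Measure.dirac (x k)) := by
    constructor
    rw [Measure.sum_apply _ MeasurableSet.univ]
    simp [← ENNReal.ofReal_tsum_of_nonneg (fun k => (ha k).1) hsummable]
  suffices hu : udimE (Measure.sum (fun k => ENNReal.ofReal (a k) • Measure.dirac (x k))) = 0 from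
    ⟨le_antisymm ((Filter.liminf_le_limsup).trans hu.le) bot_le, hu⟩
  obtain ⟨d, hd, hcover⟩ := exists_eventually_cover_of_ubdimB_lt_top hbox
  refine le_antisymm (ENNReal.le_of_forall_pos_le_add fun η hη _ => ?_) bot_le
  rw [zero_add]
  have hη' : (0 : ℝ) < η := hη
  set ε : ℝ := η / (1 + d) with hεdef
  have hε : 0 < ε := by positivity
  have hεη : ε * (1 + d) = η := div_mul_cancel₀ _ (by positivity)
  obtain ⟨F, hF⟩ := exists_finset_measure_compl_le x (fun k => ENNReal.ofReal (a k))
    (ENNReal.ofReal_pos.2 hε)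
  have hlarge : ∀ᶠ δ : ℝ in nhdsWithin 0 (Set.Ioi 0),
      (F.card + 1 + ε) / ε < -Real.log δ :=
    (Filter.tendsto_neg_atBot_atTop.comp Real.tendsto_log_nhdsGT_zero).eventually_gt_atTop _
  refine Filter.limsup_le_of_le (h := ?_)
  filter_upwards [hcover, hlarge, self_mem_nhdsWithin] with δ hδ hlarge hδ0
  obtain ⟨t, ht, hcard⟩ := hδ
  have htpos : 0 < t.card := by
    obtain ⟨z, hz, -⟩ := Set.mem_iUnion₂.1 (ht (Set.mem_univ (x 0)))
    exact Finset.card_pos.2 ⟨z, hz⟩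
  have hL : 0 < -Real.log δ := lt_trans (by positivity) hlarge
  have h2 : 0 < Real.log 2 := Real.log_pos one_lt_two
  have hlogb : -Real.logb 2 δ = -Real.log δ / Real.log 2 := by rw [Real.logb, neg_div]
  rw [hlogb]
  refine ENNReal.div_le_of_le_mul ((entropyH_ballFam_le _ F hε.le hF (le_of_lt hδ0) t ht
    htpos).trans ?_)
  rw [← ENNReal.ofReal_coe_nnreal, ← ENNReal.ofReal_mul hη'.le, ← mul_div_assoc]
  refine ENNReal.ofReal_le_ofReal ?_
  gcongr
  rw [div_lt_iff₀ hε] at hlarge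
  have := mul_le_mul_of_nonneg_left hcard hε.le
  rw [← hεη]
  linarith
end

section
/- (Hardy–Littlewood–Pólya theorem for infinite sequences.) Let a > 0 and let φ : [0,a] → ℝ₊ be a continuous concave function with φ(0) = 0. Let (x_i)_{i∈I}, (y_i)_{i∈I} ⊆ [0,a] where I = ℕ or I = {1,…,N} for some N ∈ ℕ. Assume that Σ_{i=1}^n x_i ≤ Σ_{i=1}^n y_i for every n ∈ I, that Σ_{i∈I} x_i = Σ_{i∈I} y_i (the common sum being finite), and that the sequence (x_i)_{i∈I} is nonincreasing. Then Σ_{i∈I} φ(x_i) ≥ Σ_{i∈I} φ(y_i). -/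
open MeasureTheory ENNReal

/-- A concave function on `[0,a]` has a supporting line at every interior point. -/
theorem ConcaveOn.exists_supporting_slope {a : ℝ} {φ : ℝ → ℝ}
    (hφ : ConcaveOn ℝ (Set.Icc 0 a) φ) {u : ℝ} (hu : u ∈ Set.Ioo 0 a) :
    ∃ s : ℝ, ∀ v ∈ Set.Icc 0 a, φ v ≤ φ u + s * (v - u) := by
  refine ⟨-derivWithin (-φ) (Set.Ioi u) u, fun v hv => ?_⟩
  have hi : u ∈ interior (Set.Icc 0 a) := by rwa [interior_Icc]
  rcases lt_trichotomy u v with h | rfl | h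
  · have hr := hφ.neg.rightDeriv_le_slope_of_mem_interior hi hv h
    rw [slope_def_field, le_div_iff₀ (sub_pos.2 h)] at hr
    simp only [Pi.neg_apply] at hr
    linarith
  · simp
  · have hl := (hφ.neg.slope_le_leftDeriv_of_mem_interior hv hi h).trans
      (hφ.neg.leftDeriv_le_rightDeriv_of_mem_interior hi)
    rw [slope_def_field, div_le_iff₀ (sub_pos.2 h)] at hl
    simp only [Pi.neg_apply] at hl
    linarith

/-- Slopes of supporting lines of a function on `[0,a]` decrease in the base point. -/
theorem antitoneOn_of_supporting_slopes {a : ℝ} {φ s : ℝ → ℝ}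
    (hs : ∀ u ∈ Set.Ioo 0 a, ∀ v ∈ Set.Icc 0 a, φ v ≤ φ u + s u * (v - u)) :
    AntitoneOn s (Set.Ioo 0 a) := by
  intro u hu v hv huv
  rcases huv.eq_or_lt with rfl | hlt
  · exact le_rfl
  · have h₁ := hs u hu v (Set.Ioo_subset_Icc_self hv)
    have h₂ := hs v hv u (Set.Ioo_subset_Icc_self hu)
    by_contra! h
    nlinarith [mul_pos (sub_pos.2 h) (sub_pos.2 hlt)]

/-- If all terms of `x` below `n` equal the upper bound `a` of `y` and the `n`-th partial sum of `y`
dominates that of `x`, then `y` agrees with `x` below `n`. -/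
theorem eq_of_sum_range_le_of_eq_bound {a : ℝ} {x y : ℕ → ℝ} {n : ℕ}
    (hx : ∀ i < n, x i = a) (hy : ∀ i < n, y i ≤ a)
    (hsum : ∑ i ∈ Finset.range n, x i ≤ ∑ i ∈ Finset.range n, y i) :
    ∀ i < n, y i = x i := by
  have hle : ∀ i ∈ Finset.range n, y i ≤ x i := fun i hi => by
    rw [hx i (Finset.mem_range.1 hi)]
    exact hy i (Finset.mem_range.1 hi)
  have h := (Finset.sum_eq_sum_iff_of_le hle).1 (le_antisymm (Finset.sum_le_sum hle) hsum)
  exact fun i hi => h i (Finset.mem_range.2 hi)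

/-- Summation by parts against supporting slopes: the partial sums of `φ ∘ y` exceed those of
`φ ∘ x` by at most a supporting slope times the difference of the partial sums of `y` and `x`. -/
theorem sum_range_le_add_slope_mul {a : ℝ} {φ s : ℝ → ℝ} {x y : ℕ → ℝ}
    (hs : ∀ u ∈ Set.Ioo 0 a, ∀ v ∈ Set.Icc 0 a, φ v ≤ φ u + s u * (v - u))
    (hx : ∀ i, x i ∈ Set.Icc 0 a) (hy : ∀ i, y i ∈ Set.Icc 0 a)
    (hpartial : ∀ n, ∑ i ∈ Finset.range n, x i ≤ ∑ i ∈ Finset.range n, y i)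
    (hmono : Antitone x) (n : ℕ) :
    ∀ u ∈ Set.Ioo 0 a, (∀ i < n, u ≤ x i) →
      ∑ i ∈ Finset.range n, φ (y i) ≤ ∑ i ∈ Finset.range n, φ (x i) +
        s u * (∑ i ∈ Finset.range n, y i - ∑ i ∈ Finset.range n, x i) := by
  induction n with
  | zero => simp
  | succ n ih =>
    intro u hu hux
    rcases (hx n).2.eq_or_lt with hxa | hxa
    · have hyx : ∀ i < n + 1, y i = x i :=
        eq_of_sum_range_le_of_eq_bound
          (fun i hi => le_antisymm (hx i).2 (hxa ▸ hmono (Nat.lt_succ_iff.1 hi)))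
          (fun i _ => (hy i).2) (hpartial (n + 1))
      rw [Finset.sum_congr rfl fun i hi => hyx i (Finset.mem_range.1 hi),
        Finset.sum_congr rfl fun i hi => congrArg φ (hyx i (Finset.mem_range.1 hi))]
      simp
    · have hxn : x n ∈ Set.Ioo 0 a := ⟨hu.1.trans_le (hux n n.lt_succ_self), hxa⟩
      have h₁ := ih (x n) hxn fun i hi => hmono hi.le
      have h₂ := hs (x n) hxn (y n) (hy n)
      have h₃ := mul_le_mul_of_nonneg_right
        (antitoneOn_of_supporting_slopes hs hu hxn (hux n n.lt_succ_self))
        (sub_nonneg.2 (hpartial (n + 1)))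
      simp only [Finset.sum_range_succ] at h₃ ⊢
      linarith

/-- The Hardy–Littlewood–Pólya inequality for sequences indexed by all of `ℕ`. -/
theorem hardy_littlewood_polya_nat {a : ℝ} {φ : ℝ → ℝ}
    (hφ_conc : ConcaveOn ℝ (Set.Icc 0 a) φ)
    (hφ_nonneg : ∀ t ∈ Set.Icc (0 : ℝ) a, 0 ≤ φ t) (hφ0 : φ 0 = 0) {x y : ℕ → ℝ}
    (hx : ∀ i, x i ∈ Set.Icc 0 a) (hy : ∀ i, y i ∈ Set.Icc 0 a)
    (hpartial : ∀ n, ∑ i ∈ Finset.range n, x i ≤ ∑ i ∈ Finset.range n, y i)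
    (hxs : Summable x) (hys : Summable y) (htotal : ∑' i, x i = ∑' i, y i)
    (hmono : Antitone x) :
    ∑' i, ENNReal.ofReal (φ (y i)) ≤ ∑' i, ENNReal.ofReal (φ (x i)) := by
  choose! s hs using fun u (hu : u ∈ Set.Ioo 0 a) => hφ_conc.exists_supporting_slope hu
  have hanti := antitoneOn_of_supporting_slopes hs
  have hyle : ∀ n, ∑ i ∈ Finset.range n, y i ≤ ∑' i, x i := fun n =>
    htotal ▸ hys.sum_le_tsum _ fun i _ => (hy i).1
  refine ENNReal.tsum_le_of_sum_range_le fun n => ?_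
  induction n with
  | zero => simp
  | succ n ih =>
    rcases (hx n).1.eq_or_lt with hx0 | hx0
    · have htail : ∑' i, x i = ∑ i ∈ Finset.range n, x i :=
        tsum_eq_sum fun i hi => le_antisymm
          (hx0 ▸ hmono (not_lt.1 fun h => hi (Finset.mem_range.2 h))) (hx i).1
      have hyn : y n = 0 := by
        have h := hyle (n + 1)
        rw [Finset.sum_range_succ] at h
        linarith [hpartial n, (hy n).1]
      simpa [Finset.sum_range_succ, hyn, hφ0] using ih
    · rcases (hx n).2.eq_or_lt with hxa | hxa
      · have hyx : ∀ i < n + 1, y i = x i :=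
          eq_of_sum_range_le_of_eq_bound
            (fun i hi => le_antisymm (hx i).2 (hxa ▸ hmono (Nat.lt_succ_iff.1 hi)))
            (fun i _ => (hy i).2) (hpartial (n + 1))
        rw [Finset.sum_congr rfl fun i hi =>
          congrArg (fun t => ENNReal.ofReal (φ t)) (hyx i (Finset.mem_range.1 hi))]
        exact ENNReal.sum_le_tsum _
      · have hxn : x n ∈ Set.Ioo 0 a := ⟨hx0, hxa⟩
        have hmain := sum_range_le_add_slope_mul hs hx hy hpartial hmono (n + 1) (x n) hxn
          fun i hi => hmono (Nat.lt_succ_iff.1 hi)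
        have hsplit := hxs.sum_add_tsum_nat_add (n + 1)
        have hterm : ∀ i, max (s (x n)) 0 * x (i + (n + 1)) ≤ φ (x (i + (n + 1))) := fun i => by
          rcases (hx (i + (n + 1))).1.eq_or_lt with h0 | h0
          · simp [← h0, hφ0]
          have hle : x (i + (n + 1)) ≤ x n := hmono (by lia)
          have hmem : x (i + (n + 1)) ∈ Set.Ioo 0 a := ⟨h0, hle.trans_lt hxa⟩
          rw [max_mul_of_nonneg _ _ h0.le, zero_mul]
          refine max_le ?_ (hφ_nonneg _ (hx _))
          have h₁ := hs _ hmem 0 ⟨le_rfl, (hx n).1.trans (hx n).2⟩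
          have h₂ := mul_le_mul_of_nonneg_right (hanti hmem hxn hle) h0.le
          linarith
        have hslope : s (x n) *
              (∑ i ∈ Finset.range (n + 1), y i - ∑ i ∈ Finset.range (n + 1), x i) ≤
            ∑' i, max (s (x n)) 0 * x (i + (n + 1)) := by
          rw [tsum_mul_left]
          exact mul_le_mul (le_max_left _ _) (by linarith [hyle (n + 1)])
            (sub_nonneg.2 (hpartial _)) (le_max_right _ _)
        have htail : ENNReal.ofReal (∑' i, max (s (x n)) 0 * x (i + (n + 1))) ≤
            ∑' i, ENNReal.ofReal (φ (x (i + (n + 1)))) := by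
          rw [ENNReal.ofReal_tsum_of_nonneg
            (fun i => mul_nonneg (le_max_right _ _) (hx _).1)
            (((summable_nat_add_iff (n + 1)).2 hxs).mul_left _)]
          exact ENNReal.tsum_le_tsum fun i => ENNReal.ofReal_le_ofReal (hterm i)
        calc ∑ i ∈ Finset.range (n + 1), ENNReal.ofReal (φ (y i))
            = ENNReal.ofReal (∑ i ∈ Finset.range (n + 1), φ (y i)) :=
              (ENNReal.ofReal_sum_of_nonneg fun i _ => hφ_nonneg _ (hy i)).symm
          _ ≤ ENNReal.ofReal (∑ i ∈ Finset.range (n + 1), φ (x i) +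
                ∑' i, max (s (x n)) 0 * x (i + (n + 1))) :=
              ENNReal.ofReal_le_ofReal (by linarith)
          _ ≤ ENNReal.ofReal (∑ i ∈ Finset.range (n + 1), φ (x i)) +
                ENNReal.ofReal (∑' i, max (s (x n)) 0 * x (i + (n + 1))) :=
              ENNReal.ofReal_add_le
          _ ≤ ∑ i ∈ Finset.range (n + 1), ENNReal.ofReal (φ (x i)) +
                ∑' i, ENNReal.ofReal (φ (x (i + (n + 1)))) := by
              rw [ENNReal.ofReal_sum_of_nonneg fun i _ => hφ_nonneg _ (hx i)]
              exact add_le_add le_rfl htail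
          _ = ∑' i, ENNReal.ofReal (φ (x i)) :=
              ENNReal.summable.sum_add_tsum_nat_add' (f := fun i => ENNReal.ofReal (φ (x i)))

/-- Hardy–Littlewood–Pólya theorem for possibly infinite sequences, from the
Appendix of the paper.  Here the index set `I ⊆ ℕ` is either all of `ℕ` or an initial segment
`{0,…,N-1}`; `φ : [0,a] → ℝ₊` is continuous, concave, with `φ(0)=0`; the partial sums of `x`
are dominated by those of `y`, the (finite) total sums agree, and `x` is nonincreasing on `I`.
Then `Σ_{i∈I} φ(x_i) ≥ Σ_{i∈I} φ(y_i)` (as sums in `[0,∞]`). -/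
theorem hardy_littlewood_polya_infinite
    (a : ℝ) (ha : 0 < a) (φ : ℝ → ℝ)
    (hφ_cont : ContinuousOn φ (Set.Icc 0 a))
    (hφ_conc : ConcaveOn ℝ (Set.Icc 0 a) φ)
    (hφ_nonneg : ∀ t ∈ Set.Icc (0 : ℝ) a, 0 ≤ φ t)
    (hφ0 : φ 0 = 0)
    (I : Set ℕ) (hI : I = Set.univ ∨ ∃ N : ℕ, I = Set.Iio N)
    (x y : ℕ → ℝ)
    (hx : ∀ i ∈ I, x i ∈ Set.Icc 0 a) (hy : ∀ i ∈ I, y i ∈ Set.Icc 0 a)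
    (hpartial : ∀ n ∈ I, ∑ i ∈ Finset.range (n + 1), x i ≤ ∑ i ∈ Finset.range (n + 1), y i)
    (hxsummable : Summable (fun i : I => x i))
    (hysummable : Summable (fun i : I => y i))
    (htotal : ∑' i : I, x i = ∑' i : I, y i)
    (hmono : ∀ i ∈ I, ∀ j ∈ I, i ≤ j → x j ≤ x i) :
    ∑' i : I, ENNReal.ofReal (φ (y i)) ≤ ∑' i : I, ENNReal.ofReal (φ (x i)) := by
  have hlower : ∀ i ∈ I, ∀ j ≤ i, j ∈ I := by
    rcases hI with rfl | ⟨N, rfl⟩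
    · simp
    · exact fun i hi j hj => lt_of_le_of_lt hj hi
  have hmem : ∀ z : ℕ → ℝ, (∀ i ∈ I, z i ∈ Set.Icc 0 a) → ∀ i, I.indicator z i ∈ Set.Icc 0 a := by
    intro z hz i
    by_cases hi : i ∈ I
    · simpa [hi] using hz i hi
    · simp [hi, ha.le]
  have hφsum : ∀ z : ℕ → ℝ, ∑' i : I, ENNReal.ofReal (φ (z i)) =
      ∑' i, ENNReal.ofReal (φ (I.indicator z i)) := by
    intro z
    rw [tsum_subtype I fun i => ENNReal.ofReal (φ (z i))]
    refine tsum_congr fun i => ?_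
    by_cases hi : i ∈ I <;> simp [hi, hφ0]
  have hsum_mem : ∀ z : ℕ → ℝ, ∀ n ∈ I,
      ∑ i ∈ Finset.range (n + 1), I.indicator z i = ∑ i ∈ Finset.range (n + 1), z i :=
    fun z n hn => Finset.sum_congr rfl fun i hi =>
      Set.indicator_of_mem (hlower n hn i (Nat.lt_succ_iff.1 (Finset.mem_range.1 hi))) z
  have hsum_notMem : ∀ z : ℕ → ℝ, ∀ n ∉ I,
      ∑ i ∈ Finset.range (n + 1), I.indicator z i = ∑' i : I, z i := by
    intro z n hn
    rw [tsum_subtype]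
    refine (tsum_eq_sum fun i hi => Set.indicator_of_notMem (fun hiI => hn ?_) z).symm
    exact hlower i hiI n (by simp at hi; lia)
  rw [hφsum, hφsum]
  refine hardy_littlewood_polya_nat hφ_conc hφ_nonneg hφ0 (hmem x hx) (hmem y hy) ?_
    (summable_subtype_iff_indicator.1 hxsummable) (summable_subtype_iff_indicator.1 hysummable)
    (by rw [← tsum_subtype, ← tsum_subtype, htotal]) ?_
  · rintro (_ | n)
    · simp
    · by_cases hn : n ∈ I
      · simpa only [hsum_mem _ n hn] using hpartial n hn
      · simp only [hsum_notMem _ n hn, htotal, le_refl]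
  · intro i j hij
    by_cases hj : j ∈ I
    · have hi := hlower j hj i hij
      simpa [hi, hj] using hmono i hi j hj hij
    · rw [Set.indicator_of_notMem hj]
      exact (hmem x hx i).1
end
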